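/- arXiv:2412.14740 — 10 statements merged into one kernel-verified Lean document; each statement's English description precedes it below -/
import Mathlib

section
/- Assume M is weakly multivariate Markovian with transition kernels (κ_δ)_{δ∈ℝ_{≥0}^d}. Let T = (τ_1,…,τ_d) be a multivariate stopping time taking values in a countable subset of ℝ_{≥0}^d. Then for every fixed t ∈ ℝ_{≥0}^d and every Borel set E ⊆ 𝒫, one has P-almost surely P(M(T + t) ∈ E | H_T) = κ_t(M(T))(E); no right-continuity or Feller assumption on M is needed. -/
open MeasureTheory Filter
open scoped NNReal

section MultivariateMarkov

variable {Ω X : Type*} {d : ℕ}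

/-- The multivariate filtration `H_t`: the σ-algebra generated by the random variables `M r`
with `r ≤ t` (componentwise). -/
def mvFiltration [MeasurableSpace X] (M : (Fin d → ℝ≥0) → Ω → X) (t : Fin d → ℝ≥0) :
    MeasurableSpace Ω :=
  ⨆ (r : Fin d → ℝ≥0) (_ : r ≤ t), MeasurableSpace.comap (M r) inferInstance

/-- `T` is a multivariate stopping time if `{T ≤ t} ∈ H_t` for every `t`. -/
def IsMVStoppingTime [MeasurableSpace X] (M : (Fin d → ℝ≥0) → Ω → X)
    (T : Ω → Fin d → ℝ≥0) : Prop :=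
  ∀ t, MeasurableSet[mvFiltration M t] {ω | T ω ≤ t}

/-- The σ-algebra `H_T` of a multivariate stopping time `T`: events `A ∈ ℱ` such that
`A ∩ {T ≤ t} ∈ H_t` for every `t`. -/
def stoppingSigma [mΩ : MeasurableSpace Ω] [MeasurableSpace X]
    (M : (Fin d → ℝ≥0) → Ω → X) (T : Ω → Fin d → ℝ≥0)
    (hT : IsMVStoppingTime M T) : MeasurableSpace Ω where
  MeasurableSet' A := MeasurableSet[mΩ] A ∧
    ∀ t, MeasurableSet[mvFiltration M t] (A ∩ {ω | T ω ≤ t})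
  measurableSet_empty := ⟨MeasurableSet.empty, fun t => by simp⟩
  measurableSet_compl := by
    rintro A ⟨hA, hA2⟩
    refine ⟨hA.compl, fun t => ?_⟩
    have h : Aᶜ ∩ {ω | T ω ≤ t} = {ω | T ω ≤ t} \ (A ∩ {ω | T ω ≤ t}) := by
      ext ω; by_cases hω : ω ∈ A <;> simp [hω]
    rw [h]
    exact (hT t).diff (hA2 t)
  measurableSet_iUnion := by
    rintro f hf
    refine ⟨MeasurableSet.iUnion fun i => (hf i).1, fun t => ?_⟩
    rw [Set.iUnion_inter]
    exact MeasurableSet.iUnion fun i => (hf i).2 t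

theorem mvFiltration_mono' [MeasurableSpace X] (M : (Fin d → ℝ≥0) → Ω → X)
    {s t : Fin d → ℝ≥0} (h : s ≤ t) : mvFiltration M s ≤ mvFiltration M t :=
  iSup₂_le fun r hr => le_iSup₂_of_le r (hr.trans h) le_rfl

theorem mvStopping_eq_meas [MeasurableSpace X] (M : (Fin d → ℝ≥0) → Ω → X)
    (T : Ω → Fin d → ℝ≥0) (hT : IsMVStoppingTime M T)
    (S : Set (Fin d → ℝ≥0)) (hS : S.Countable) (hTS : ∀ ω, T ω ∈ S) (s : Fin d → ℝ≥0) :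
    MeasurableSet[mvFiltration M s] {ω | T ω = s} := by
  have h : {ω | T ω = s} =
      {ω | T ω ≤ s} \ ⋃ r ∈ {r ∈ S | r ≤ s ∧ r ≠ s}, {ω | T ω ≤ r} := by
    ext ω
    simp only [Set.mem_setOf_eq, Set.mem_diff, Set.mem_iUnion, not_exists, exists_prop, not_and]
    constructor
    · rintro rfl
      exact ⟨le_rfl, fun r hr hle => hr.2.2 (le_antisymm hr.2.1 hle)⟩
    · rintro ⟨hle, hn⟩
      by_contra hne
      exact hn (T ω) ⟨hTS ω, hle, hne⟩ le_rfl
  rw [h]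
  refine (hT s).diff (MeasurableSet.biUnion (hS.mono fun r hr => hr.1) fun r hr => ?_)
  exact mvFiltration_mono' M hr.2.1 _ (hT r)

/-- strong multivariate Markov property at countably valued stopping times: if `M`
is weakly multivariate Markovian with transition kernels `κ` and `T` is a multivariate stopping
time taking values in a countable set, then for every fixed `t` and every Borel set `E`, one has
`P(M(T + t) ∈ E | H_T) = κ_t(M(T))(E)` almost surely; no right-continuity or Feller assumption
is needed. -/
theorem strong_multivariate_markov_countable [mΩ : MeasurableSpace Ω] (P : Measure Ω)
    [IsProbabilityMeasure P]
    [TopologicalSpace X] [PolishSpace X] [MeasurableSpace X] [BorelSpace X]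
    (hd : 1 ≤ d)
    (M : (Fin d → ℝ≥0) → Ω → X)
    (hM : Measurable fun p : (Fin d → ℝ≥0) × Ω => M p.1 p.2)
    (κ : (Fin d → ℝ≥0) → ProbabilityTheory.Kernel X X)
    (hκ : ∀ δ, ProbabilityTheory.IsMarkovKernel (κ δ))
    -- weak multivariate Markovianity
    (hMarkov : ∀ (t δ : Fin d → ℝ≥0) (E : Set X), MeasurableSet E →
      P[Set.indicator {ω | M (t + δ) ω ∈ E} (fun _ => (1 : ℝ)) | mvFiltration M t]
        =ᵐ[P] fun ω => (κ δ (M t ω) E).toReal)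
    (T : Ω → Fin d → ℝ≥0) (hTmeas : Measurable T) (hT : IsMVStoppingTime M T)
    -- `T` takes values in a countable set
    (S : Set (Fin d → ℝ≥0)) (hS : S.Countable) (hTS : ∀ ω, T ω ∈ S)
    (t : Fin d → ℝ≥0) (E : Set X) (hE : MeasurableSet E) :
    P[Set.indicator {ω | M (T ω + t) ω ∈ E} (fun _ => (1 : ℝ)) | stoppingSigma M T hT]
      =ᵐ[P] fun ω => (κ t (M (T ω) ω) E).toReal := by
  have hMr : ∀ r, Measurable (M r) := fun r => hM.comp (measurable_const.prodMk measurable_id)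
  have hle : ∀ s, mvFiltration M s ≤ mΩ := fun s =>
    iSup₂_le fun r _ => (hMr r).comap_le
  have hleT : stoppingSigma M T hT ≤ mΩ := fun A hA => hA.1
  have hTs := mvStopping_eq_meas M T hT S hS hTS
  have hiff : ∀ s A, MeasurableSet[stoppingSigma M T hT] ({ω | T ω = s} ∩ A) ↔
      MeasurableSet[mvFiltration M s] ({ω | T ω = s} ∩ A) := by
    intro s A
    constructor
    · intro h
      have h2 := h.2 s
      have e : {ω | T ω = s} ∩ A ∩ {ω | T ω ≤ s} = {ω | T ω = s} ∩ A := by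
        refine Set.inter_eq_left.2 fun ω hω => ?_
        exact le_of_eq hω.1
      rwa [e] at h2
    · intro h
      refine ⟨hle s _ h, fun u => ?_⟩
      by_cases hsu : s ≤ u
      · have e : {ω | T ω = s} ∩ A ∩ {ω | T ω ≤ u} = {ω | T ω = s} ∩ A := by
          refine Set.inter_eq_left.2 fun ω hω => ?_
          exact (le_of_eq hω.1).trans hsu
        rw [e]
        exact mvFiltration_mono' M hsu _ h
      · have e : {ω | T ω = s} ∩ A ∩ {ω | T ω ≤ u} = ∅ := by
          refine Set.eq_empty_of_forall_notMem fun ω hω => hsu ?_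
          have h1 : T ω = s := hω.1.1
          have h2 : T ω ≤ u := hω.2
          rwa [h1] at h2
        rw [e]
        exact @MeasurableSet.empty _ (mvFiltration M u)
  have hTsT : ∀ s, MeasurableSet[stoppingSigma M T hT] {ω | T ω = s} := by
    intro s
    have := (hiff s Set.univ).2 (by simpa using hTs s)
    simpa using this
  have hint : ∀ B : Set Ω, MeasurableSet B → Integrable (B.indicator (fun _ => (1 : ℝ))) P :=
    fun B hB => (integrable_const 1).indicator hB
  have hB : MeasurableSet {ω | M (T ω + t) ω ∈ E} :=
    (hM.comp ((hTmeas.add_const t).prodMk measurable_id)) hE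
  have key : ∀ s ∈ S, ∀ᵐ ω ∂P, T ω = s →
      (P[Set.indicator {ω | M (T ω + t) ω ∈ E} (fun _ => (1 : ℝ)) | stoppingSigma M T hT]) ω
        = (κ t (M (T ω) ω) E).toReal := by
    intro s _
    have hBs : MeasurableSet {ω | M (s + t) ω ∈ E} := hMr (s + t) hE
    have h1 := condExp_indicator (m := stoppingSigma M T hT) (hint _ hB) (hTsT s)
    have h2 := condExp_indicator (m := stoppingSigma M T hT) (hint _ hBs) (hTsT s)
    have e : {ω | T ω = s}.indicator
          (Set.indicator {ω | M (T ω + t) ω ∈ E} (fun _ => (1 : ℝ))) =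
        {ω | T ω = s}.indicator
          (Set.indicator {ω | M (s + t) ω ∈ E} (fun _ => (1 : ℝ))) := by
      refine Set.indicator_congr fun ω hω => ?_
      have h : T ω = s := hω
      have hi : ω ∈ {ω | M (T ω + t) ω ∈ E} ↔ ω ∈ {ω | M (s + t) ω ∈ E} := by
        change M (T ω + t) ω ∈ E ↔ M (s + t) ω ∈ E
        rw [h]
      by_cases hc : ω ∈ {ω | M (s + t) ω ∈ E}
      · rw [Set.indicator_of_mem hc, Set.indicator_of_mem (hi.2 hc)]
      · rw [Set.indicator_of_notMem hc, Set.indicator_of_notMem (fun h' => hc (hi.1 h'))]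
    rw [e] at h1
    have h3 := condExp_ae_eq_restrict_of_measurableSpace_eq_on (μ := P)
      (f := Set.indicator {ω | M (s + t) ω ∈ E} (fun _ => (1 : ℝ)))
      hleT (hle s) (hTsT s) (hiff s)
    have h3' := (ae_restrict_iff' (hle s _ (hTs s))).1 h3
    filter_upwards [h1, h2, h3', hMarkov s t E hE] with ω h1 h2 h3 h4 hω
    have hm : ω ∈ {ω | T ω = s} := hω
    rw [h1, Set.indicator_of_mem hm, Set.indicator_of_mem hm] at h2
    rw [h2, h3 hm, h4, hω]
  filter_upwards [(ae_ball_iff hS).2 key] with ω h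
  exact h (T ω) (hTS ω) rfl

end MultivariateMarkov
end

section
/- Let (Y_n)_{n≥1} be {0,1}-valued random variables, not necessarily independent or identically distributed, and let q > 0 be such that for every n ≥ 1, P(Y_n = 1 | σ(Y_1,…,Y_{n−1})) ≥ q almost surely (for n = 1 this means P(Y_1 = 1) ≥ q). Then for every η ∈ (0, q) and every integer n₀ ≥ 1, P( ∑_{i=1}^n Y_i ≥ n(q − η) for all n ≥ n₀ ) ≥ 1 − 2 η^{−2} exp(−2 η² n₀). -/
open MeasureTheory

lemma aux_hoeffding (q : ℝ) (h0 : 0 ≤ q) (h1 : q ≤ 1) (t : ℝ) :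
    1 - q * (1 - Real.exp (-t)) ≤ Real.exp (-t * q + t ^ 2 / 8) := by
  let μ : Measure ℝ := ENNReal.ofReal q • Measure.dirac 1 + ENNReal.ofReal (1 - q) • Measure.dirac 0
  have hint : ∀ f : ℝ → ℝ, ∫ x, f x ∂μ = q * f 1 + (1 - q) * f 0 := by
    intro f
    have hi : ∀ (a c : ℝ), Integrable f (ENNReal.ofReal c • Measure.dirac a) := fun a c =>
      (integrable_dirac (by simp)).smul_measure (by simp)
    rw [integral_add_measure (hi _ _) (hi _ _), integral_smul_measure, integral_smul_measure,
      integral_dirac, integral_dirac, ENNReal.toReal_ofReal h0, ENNReal.toReal_ofReal (by linarith)]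
    simp
  have hP : IsProbabilityMeasure μ := by
    constructor
    simp only [μ, Measure.add_apply, Measure.smul_apply, measure_univ, smul_eq_mul, mul_one]
    rw [← ENNReal.ofReal_add h0 (by linarith)]
    simp
  have hb : ∀ᵐ x ∂μ, id x ∈ Set.Icc (0 : ℝ) 1 := by
    have hs : MeasurableSet (Set.Icc (0:ℝ) 1)ᶜ := measurableSet_Icc.compl
    change μ (Set.Icc (0:ℝ) 1)ᶜ = 0
    simp [μ, Measure.dirac_apply' _ hs]
  have h := (ProbabilityTheory.hasSubgaussianMGF_of_mem_Icc (X := id) (μ := μ)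
    aemeasurable_id hb).mgf_le (-t)
  rw [ProbabilityTheory.mgf, hint, hint] at h
  have e1 : Real.exp (-t * (id 1 - (q * id 1 + (1 - q) * id 0)))
      = Real.exp (-t) * Real.exp (t * q) := by
    rw [← Real.exp_add]; congr 1; simp; ring
  have e2 : Real.exp (-t * (id 0 - (q * id 1 + (1 - q) * id 0))) = Real.exp (t * q) := by
    congr 1; simp
  rw [e1, e2] at h
  have e3 : Real.exp (-t * q + t ^ 2 / 8) = Real.exp (-t*q) * Real.exp (t^2/8) := Real.exp_add _ _
  have e4 : Real.exp (-t*q) * Real.exp (t * q) = 1 := by rw [← Real.exp_add]; simp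
  have h' : (1 - q * (1 - Real.exp (-t))) * Real.exp (t*q) ≤ Real.exp (t^2/8) := by
    refine le_trans (le_of_eq (by ring)) (h.trans (le_of_eq ?_))
    congr 1
    simp
    ring
  rw [e3]
  calc _ = Real.exp (-t*q) * ((1 - q * (1 - Real.exp (-t))) * Real.exp (t*q)) := by
        linear_combination (-(1 - q * (1 - Real.exp (-t)))) * e4
    _ ≤ _ := by gcongr

lemma aux_mgf {Ω : Type*} [mΩ : MeasurableSpace Ω] (P : Measure Ω)
    [IsProbabilityMeasure P]
    (Y : ℕ → Ω → ℝ) (hmeas : ∀ n, Measurable (Y n))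
    (hval : ∀ n ω, Y n ω = 0 ∨ Y n ω = 1)
    (q : ℝ) (hq1 : q ≤ 1)
    (hcond : ∀ n, (fun _ => q) ≤ᵐ[P]
      P[Y n | ⨆ i < n, MeasurableSpace.comap (Y i) inferInstance])
    (t : ℝ) (ht : 0 < t) (n : ℕ) :
    Integrable (fun ω => Real.exp (-t * ∑ i ∈ Finset.range n, Y i ω)) P ∧
    ∫ ω, Real.exp (-t * ∑ i ∈ Finset.range n, Y i ω) ∂P ≤ (1 - q * (1 - Real.exp (-t))) ^ n := by
  have hY0 : ∀ n ω, 0 ≤ Y n ω := fun n ω => by rcases hval n ω with h | h <;> simp [h]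
  have hY1 : ∀ n ω, Y n ω ≤ 1 := fun n ω => by rcases hval n ω with h | h <;> simp [h]
  have hYi : ∀ n, Integrable (Y n) P := fun n =>
    Integrable.of_bound (hmeas n).aestronglyMeasurable 1 (ae_of_all _ fun ω => by
      rw [Real.norm_eq_abs, abs_of_nonneg (hY0 n ω)]; exact hY1 n ω)
  have het : Real.exp (-t) < 1 := by simpa using ht
  have hpos := Real.exp_pos (-t)
  have hWle : ∀ n ω, Real.exp (-t * ∑ i ∈ Finset.range n, Y i ω) ≤ 1 := fun n ω => by
    have : 0 ≤ ∑ i ∈ Finset.range n, Y i ω := Finset.sum_nonneg fun i _ => hY0 i ω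
    rw [Real.exp_le_one_iff]; nlinarith
  have hWi : ∀ n, Integrable (fun ω => Real.exp (-t * ∑ i ∈ Finset.range n, Y i ω)) P := fun n =>
    Integrable.of_bound (by fun_prop) 1 (ae_of_all _ fun ω => by
      rw [Real.norm_eq_abs, Real.abs_exp]; exact hWle n ω)
  refine ⟨hWi n, ?_⟩
  induction n with
  | zero => simp
  | succ n ih =>
    set W : Ω → ℝ := fun ω => Real.exp (-t * ∑ i ∈ Finset.range n, Y i ω) with hW
    set m : MeasurableSpace Ω := ⨆ i < n, MeasurableSpace.comap (Y i) inferInstance with hm_def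
    have hm : m ≤ mΩ := iSup₂_le fun i _ => (hmeas i).comap_le
    have hWm : StronglyMeasurable[m] W := by
      have hs : Measurable[m] (fun ω => ∑ i ∈ Finset.range n, Y i ω) := by
        refine Finset.measurable_fun_sum _ fun i hi => ?_
        refine Measurable.mono (comap_measurable (Y i)) ?_ le_rfl
        exact le_iSup₂_of_le i (Finset.mem_range.1 hi) le_rfl
      exact (Real.measurable_exp.comp (hs.const_mul (-t))).stronglyMeasurable
    have hWYi : Integrable (W * Y n) P :=
      (hYi n).bdd_mul (c := 1) (hWi n).aestronglyMeasurable (ae_of_all _ fun ω => by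
        rw [Real.norm_eq_abs, Real.abs_exp]; exact hWle n ω)
    have hpull := condExp_mul_of_stronglyMeasurable_left hWm hWYi (hYi n)
    have hge : q * ∫ ω, W ω ∂P ≤ ∫ ω, (W * Y n) ω ∂P := by
      rw [← integral_condExp hm (f := W * Y n), ← integral_const_mul]
      refine integral_mono_ae ((hWi n).const_mul q) integrable_condExp ?_
      filter_upwards [hpull, hcond n] with ω h1 h2
      rw [h1, Pi.mul_apply, mul_comm]
      exact mul_le_mul_of_nonneg_left h2 (Real.exp_pos _).le
    have heq : (fun ω => Real.exp (-t * ∑ i ∈ Finset.range (n+1), Y i ω))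
        = fun ω => W ω - (1 - Real.exp (-t)) * (W * Y n) ω := by
      funext ω
      rw [Finset.sum_range_succ, mul_add, Real.exp_add, Pi.mul_apply]
      rcases hval n ω with h | h <;> simp [h, hW] <;> ring
    rw [heq, integral_sub (hWi n) (hWYi.const_mul _), integral_const_mul, pow_succ]
    have hc : 0 ≤ 1 - q * (1 - Real.exp (-t)) := by nlinarith
    nlinarith [mul_le_mul_of_nonneg_left hge (sub_nonneg.2 het.le),
      mul_le_mul_of_nonneg_right ih hc]

/-- If `(Y_n)` are `{0,1}`-valued random variables whose conditional probability of
being `1` given the past is at least `q > 0`, then with probability at least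
`1 − 2 η⁻² exp(−2 η² n₀)` one has `∑_{i=1}^n Y_i ≥ n (q − η)` simultaneously for all `n ≥ n₀`. -/
theorem drift_exponential {Ω : Type*} [MeasurableSpace Ω] (P : Measure Ω)
    [IsProbabilityMeasure P]
    (Y : ℕ → Ω → ℝ) (hmeas : ∀ n, Measurable (Y n))
    (hval : ∀ n ω, Y n ω = 0 ∨ Y n ω = 1)
    (q : ℝ) (hq : 0 < q)
    (hcond : ∀ n, (fun _ => q) ≤ᵐ[P]
      P[Set.indicator {ω | Y n ω = 1} (fun _ => (1 : ℝ)) |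
        ⨆ i < n, MeasurableSpace.comap (Y i) inferInstance])
    (η : ℝ) (hη0 : 0 < η) (hηq : η < q) (n₀ : ℕ) (hn₀ : 1 ≤ n₀) :
    ENNReal.ofReal (1 - 2 / η ^ 2 * Real.exp (-2 * η ^ 2 * n₀)) ≤
      P {ω | ∀ n, n₀ ≤ n → (n : ℝ) * (q - η) ≤ ∑ i ∈ Finset.range n, Y i ω} := by
  have hind : ∀ n, Set.indicator {ω | Y n ω = 1} (fun _ => (1 : ℝ)) = Y n := by
    intro n; funext ω
    rcases hval n ω with h | h <;> simp [Set.indicator, h]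
  simp only [hind] at hcond
  have hY0 : ∀ n ω, 0 ≤ Y n ω := fun n ω => by rcases hval n ω with h | h <;> simp [h]
  have hY1 : ∀ n ω, Y n ω ≤ 1 := fun n ω => by rcases hval n ω with h | h <;> simp [h]
  have hq1 : q ≤ 1 := by
    have hm : (⨆ i < 0, MeasurableSpace.comap (Y i) inferInstance) ≤ ‹MeasurableSpace Ω› :=
      iSup₂_le fun i _ => (hmeas i).comap_le
    have h := integral_mono_ae (integrable_const q) integrable_condExp (hcond 0)
    rw [integral_condExp hm] at h
    have h2 : ∫ ω, Y 0 ω ∂P ≤ ∫ ω, (1:ℝ) ∂P :=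
      integral_mono_of_nonneg (ae_of_all _ (hY0 0)) (integrable_const _) (ae_of_all _ (hY1 0))
    simp at h h2
    linarith
  set x : ℝ := 2 * η ^ 2 with hx
  have hx0 : 0 < x := by positivity
  have hx2 : x ≤ 2 := by nlinarith
  have hsingle : ∀ n : ℕ, P {ω | ∑ i ∈ Finset.range n, Y i ω ≤ (n : ℝ) * (q - η)}
      ≤ ENNReal.ofReal (Real.exp (-x) ^ n) := by
    intro n
    obtain ⟨hi, hle⟩ := aux_mgf P Y hmeas hval q hq1 hcond (4 * η) (by positivity) n
    have hch := ProbabilityTheory.measure_le_le_exp_mul_mgf (μ := P)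
      (X := fun ω => ∑ i ∈ Finset.range n, Y i ω) (t := -(4 * η)) ((n : ℝ) * (q - η))
      (by linarith) hi
    rw [← ENNReal.ofReal_toReal (measure_ne_top P _)]
    refine ENNReal.ofReal_le_ofReal (hch.trans ?_)
    have hc : 0 ≤ 1 - q * (1 - Real.exp (-(4*η))) := by
      nlinarith [Real.exp_pos (-(4*η))]
    have hp := pow_le_pow_left₀ hc (aux_hoeffding q hq.le hq1 (4 * η)) n
    calc _ ≤ Real.exp (-(-(4*η)) * ((n : ℝ) * (q - η)))
          * Real.exp (-(4 * η) * q + (4*η) ^ 2 / 8) ^ n := by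
            gcongr
            exact hle.trans hp
      _ = _ := by
        rw [← Real.exp_nat_mul, ← Real.exp_nat_mul, ← Real.exp_add]
        congr 1
        rw [hx]; ring
  set A : Set Ω := {ω | ∀ n, n₀ ≤ n → (n : ℝ) * (q - η) ≤ ∑ i ∈ Finset.range n, Y i ω} with hA
  have hr0 := Real.exp_pos (-x)
  have hr1 : Real.exp (-x) < 1 := by simpa using hx0
  have hcompl : P Aᶜ ≤ ENNReal.ofReal (2 / η ^ 2 * Real.exp (-2 * η ^ 2 * n₀)) := by
    have hsub : Aᶜ ⊆ ⋃ k : ℕ, {ω | ∑ i ∈ Finset.range (n₀ + k), Y i ω ≤ ((n₀ + k : ℕ) : ℝ) * (q - η)} := by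
      intro ω hω
      simp only [hA, Set.mem_compl_iff, Set.mem_setOf_eq, not_forall, not_le] at hω
      obtain ⟨n, hn, h⟩ := hω
      obtain ⟨k, rfl⟩ := Nat.exists_eq_add_of_le hn
      exact Set.mem_iUnion.2 ⟨k, h.le⟩
    have hsum : HasSum (fun k => Real.exp (-x) ^ (n₀ + k))
        (Real.exp (-x) ^ n₀ * (1 - Real.exp (-x))⁻¹) := by
      simp only [pow_add]
      exact (hasSum_geometric_of_lt_one hr0.le hr1).mul_left _
    calc P Aᶜ ≤ ∑' k : ℕ, P {ω | ∑ i ∈ Finset.range (n₀ + k), Y i ω ≤ ((n₀ + k : ℕ) : ℝ) * (q - η)} :=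
          (measure_mono hsub).trans (measure_iUnion_le _)
      _ ≤ ∑' k : ℕ, ENNReal.ofReal (Real.exp (-x) ^ (n₀ + k)) :=
          ENNReal.tsum_le_tsum fun k => hsingle _
      _ = ENNReal.ofReal (Real.exp (-x) ^ n₀ * (1 - Real.exp (-x))⁻¹) := by
          rw [← hsum.tsum_eq, ENNReal.ofReal_tsum_of_nonneg (fun k => by positivity) hsum.summable]
      _ ≤ _ := by
          refine ENNReal.ofReal_le_ofReal ?_
          have e : Real.exp (-2 * η ^ 2 * n₀) = Real.exp (-x) ^ n₀ := by
            rw [← Real.exp_nat_mul]; congr 1; rw [hx]; ring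
          have e2 : 2 / η ^ 2 = 4 / x := by rw [hx]; field_simp; norm_num
          rw [e, e2, mul_comm]
          gcongr
          have h1 : Real.exp (-x) ≤ 1 / (1 + x) := by
            rw [Real.exp_neg, ← one_div]
            exact one_div_le_one_div_of_le (by linarith) (by linarith [Real.add_one_le_exp x])
          have h2 : x / 4 ≤ 1 - 1 / (1 + x) := by
            have : 1 - 1 / (1 + x) = x / (1 + x) := by field_simp; ring
            rw [this]
            exact div_le_div_of_nonneg_left hx0.le (by linarith) (by linarith)
          rw [← inv_div]
          exact inv_anti₀ (by positivity) (by linarith)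
  have hone : 1 ≤ P A + P Aᶜ := by
    have := measure_union_le (μ := P) A Aᶜ
    rwa [Set.union_compl_self, measure_univ] at this
  rw [ENNReal.ofReal_sub _ (by positivity), ENNReal.ofReal_one]
  exact tsub_le_iff_right.2 (hone.trans (by gcongr))
end

section
/- For every ζ ∈ (0, 1/2) there exist constants c₁, c₂, c₃ > 0, depending only on ζ, such that the following holds for every η ∈ (0,1), every integer J ≥ c₁ ln(c₂/η)² / η², and every γ ∈ [0,1). Let (B_t)_{t≥0} be a standard one-dimensional Brownian motion and set N₊ := #{ j ∈ {0, 1, …, J} : |B_{γ+j}| ∈ [1+ζ, 2−ζ] }. Then P( N₊ ≥ c₃ η √J ) ≥ 1 − η. -/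
open MeasureTheory ProbabilityTheory Filter
open scoped NNReal

/-- A standard one-dimensional Brownian motion: starts at `0`, has a.s. continuous sample paths
(on `[0,∞)`), and for `0 ≤ s ≤ t` the increment `B_t − B_s` is centered Gaussian with variance
`t − s` and independent of the past `(B_r)_{0 ≤ r ≤ s}`. -/
structure IsStdBrownianMotion {Ω : Type*} [MeasurableSpace Ω] (P : Measure Ω)
    (B : ℝ → Ω → ℝ) : Prop where
  isProb : IsProbabilityMeasure P
  meas : ∀ t, Measurable (B t)
  init : ∀ᵐ ω ∂P, B 0 ω = 0
  cont : ∀ᵐ ω ∂P, ContinuousOn (fun t => B t ω) (Set.Ici 0)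
  incr : ∀ s t : ℝ, 0 ≤ s → s ≤ t →
    Measure.map (fun ω => B t ω - B s ω) P = gaussianReal 0 (Real.toNNReal (t - s))
  indep : ∀ s t : ℝ, 0 ≤ s → s ≤ t →
    Indep (⨆ r ∈ Set.Icc (0 : ℝ) s, MeasurableSpace.comap (B r) inferInstance)
      (MeasurableSpace.comap (fun ω => B t ω - B s ω) inferInstance) P

def stripA (ζ : ℝ) : Set ℝ := {x | |x| ∈ Set.Icc (1 + ζ) (2 - ζ)}

lemma stripA_meas (ζ : ℝ) : MeasurableSet (stripA ζ) :=
  measurableSet_Icc.preimage measurable_norm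

/-- tilt comparison of densities -/
lemma pdf_compare (x y a : ℝ) (hx : 0 ≤ x) (hy : y ≤ 0) (ha : 0 ≤ a) (ha2 : a ≤ 2) :
    gaussianPDFReal x 1 y ≤ 100 * gaussianPDFReal 0 1 y * gaussianPDFReal x 1 a := by
  have hpi : Real.sqrt (2 * Real.pi * (1:ℝ≥0)) ≤ 4 := by
    rw [Real.sqrt_le_left (by norm_num)]
    have := Real.pi_lt_d2
    push_cast
    nlinarith
  have hpi0 : 0 < Real.sqrt (2 * Real.pi * (1:ℝ≥0)) := by positivity
  have hexp : Real.exp 2 ≤ 9 := by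
    have := Real.exp_one_lt_d9
    have h2 : Real.exp 2 = Real.exp 1 * Real.exp 1 := by rw [← Real.exp_add]; norm_num
    have := Real.exp_pos 1
    rw [h2]; nlinarith
  simp only [gaussianPDFReal]
  set S := Real.sqrt (2 * Real.pi * (1:ℝ≥0))
  have key : Real.exp (-(y - x) ^ 2 / (2 * (1:ℝ≥0))) ≤
      Real.exp 2 * (Real.exp (-(y - 0) ^ 2 / (2 * (1:ℝ≥0))) * Real.exp (-(a - x) ^ 2 / (2 * (1:ℝ≥0)))) := by
    rw [← Real.exp_add, ← Real.exp_add]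
    apply Real.exp_le_exp.mpr
    push_cast
    nlinarith [mul_nonneg hx ha, mul_nonneg hx (neg_nonneg.mpr hy)]
  set E1 := Real.exp (-(y - x) ^ 2 / (2 * (1:ℝ≥0)))
  set E2 := (Real.exp (-(y - 0) ^ 2 / (2 * (1:ℝ≥0))) * Real.exp (-(a - x) ^ 2 / (2 * (1:ℝ≥0)))) with hE2
  have hE2p : 0 < E2 := by positivity
  calc S⁻¹ * E1 ≤ S⁻¹ * (Real.exp 2 * E2) := by gcongr
    _ = S⁻¹ * S⁻¹ * E2 * (S * Real.exp 2) := by field_simp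
    _ ≤ S⁻¹ * S⁻¹ * E2 * 100 := by
      gcongr
      have := Real.exp_pos 2
      nlinarith
    _ = _ := by rw [hE2]; ring

lemma exp_int (x c : ℝ) : Integrable (fun y => Real.exp (c * y)) (gaussianReal x 1) :=
  integrable_exp_mul_gaussianReal c

lemma exp_integral (x c : ℝ) : ∫ y, Real.exp (c * y) ∂(gaussianReal x 1)
    = Real.exp (x * c + c ^ 2 / 2) := by
  have := congrFun (mgf_id_gaussianReal (μ := x) (v := 1)) c
  simpa [mgf] using this

noncomputable def negExp (y : ℝ) : ℝ := (Set.Iio (0:ℝ)).indicator (fun y => Real.exp (-2 * y)) y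

lemma negExp_int (x : ℝ) : Integrable negExp (gaussianReal x 1) :=
  (exp_int x (-2)).indicator measurableSet_Iio

lemma negExp_nonneg (y : ℝ) : 0 ≤ negExp y :=
  Set.indicator_nonneg (fun _ _ => (Real.exp_pos _).le) y

lemma negExp_bound (ζ : ℝ) (hζ0 : 0 < ζ) (hζ : ζ < 1 / 2) (x : ℝ) (hx : 0 ≤ x) :
    (1 - 2 * ζ) * ∫ y, negExp y ∂(gaussianReal x 1) ≤
      100 * Real.exp 2 * (gaussianReal x 1).real (stripA ζ) := by
  have hH0 : ∫ y, negExp y ∂(gaussianReal 0 1) ≤ Real.exp 2 := by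
    calc ∫ y, negExp y ∂(gaussianReal 0 1) ≤ ∫ y, Real.exp (-2 * y) ∂(gaussianReal 0 1) := by
          apply integral_mono (negExp_int 0) (exp_int 0 (-2))
          exact Set.indicator_le_self' (fun _ _ => (Real.exp_pos _).le)
      _ = _ := by rw [exp_integral]; norm_num
  set I := ∫ y, negExp y ∂(gaussianReal x 1) with hI
  have h1 : ∀ a ∈ Set.Icc (1 + ζ) (2 - ζ), I ≤ 100 * Real.exp 2 * gaussianPDFReal x 1 a := by
    intro a ha
    have hp : 0 ≤ gaussianPDFReal x 1 a := gaussianPDFReal_nonneg _ _ _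
    have : I ≤ (100 * gaussianPDFReal x 1 a) * ∫ y, negExp y ∂(gaussianReal 0 1) := by
      rw [hI, integral_gaussianReal_eq_integral_smul one_ne_zero,
        integral_gaussianReal_eq_integral_smul one_ne_zero, ← integral_const_mul]
      have hint : ∀ x, Integrable (fun y => gaussianPDFReal x 1 y • negExp y) := by
        intro x
        have := negExp_int x
        rw [gaussianReal_of_var_ne_zero _ one_ne_zero,
          integrable_withDensity_iff_integrable_smul₀' (measurable_gaussianPDF _ _).aemeasurable
            (by simp [gaussianPDF])] at this
        simpa [toReal_gaussianPDF] using this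
      apply integral_mono (hint x) ((hint 0).const_mul _)
      intro y
      simp only [smul_eq_mul]
      by_cases hy : y < 0
      · have := pdf_compare x y a hx hy.le (by linarith [ha.1]) (by linarith [ha.2])
        calc _ ≤ (100 * gaussianPDFReal 0 1 y * gaussianPDFReal x 1 a) * negExp y :=
              mul_le_mul_of_nonneg_right this (negExp_nonneg y)
          _ = _ := by ring
      · simp [negExp, hy]
    calc I ≤ _ := this
      _ ≤ (100 * gaussianPDFReal x 1 a) * Real.exp 2 := by gcongr
      _ = _ := by ring
  have hsub : Set.Icc (1 + ζ) (2 - ζ) ⊆ stripA ζ := by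
    intro a ha
    have : |a| = a := abs_of_nonneg (by linarith [ha.1])
    simpa [stripA, this] using ha
  have h2 : (gaussianReal x 1).real (Set.Icc (1 + ζ) (2 - ζ)) =
      ∫ a in Set.Icc (1 + ζ) (2 - ζ), gaussianPDFReal x 1 a := by
    rw [Measure.real, gaussianReal_apply_eq_integral _ one_ne_zero, ENNReal.toReal_ofReal]
    exact integral_nonneg (fun _ => gaussianPDFReal_nonneg _ _ _)
  have h3 : (1 - 2 * ζ) * I ≤ ∫ a in Set.Icc (1 + ζ) (2 - ζ), 100 * Real.exp 2 * gaussianPDFReal x 1 a := by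
    have : (1 - 2 * ζ) * I = ∫ a in Set.Icc (1 + ζ) (2 - ζ), I := by
      rw [setIntegral_const]
      simp only [Measure.real, Real.volume_Icc, smul_eq_mul]
      rw [ENNReal.toReal_ofReal (by linarith)]; ring
    rw [this]
    apply setIntegral_mono_on (by simp) _ measurableSet_Icc h1
    exact ((integrable_gaussianPDFReal x 1).const_mul _).integrableOn
  rw [integral_const_mul, ← h2] at h3
  refine h3.trans ?_
  exact mul_le_mul_of_nonneg_left (measureReal_mono (μ := gaussianReal x 1) hsub) (by positivity)

lemma exp_abs_lower (s y : ℝ) (hs : 0 ≤ s) (hs1 : s ≤ 1) :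
    Real.exp (-s * y) - 2 * s * negExp y ≤ Real.exp (-s * |y|) := by
  by_cases hy : y < 0
  · have h1 : negExp y = Real.exp (-2 * y) := by simp [negExp, hy]
    rw [h1, abs_of_neg hy]
    obtain ⟨u, rfl⟩ : ∃ u, y = -u := ⟨-y, by simp⟩
    have hu : 0 < u := by linarith
    have e1 : Real.exp (-s * -u) * Real.exp (-(2*(s*u))) = Real.exp (-s * - -u) := by
      rw [← Real.exp_add]; congr 1; ring
    have e2 := Real.add_one_le_exp (-(2*(s*u)))
    have e3 : Real.exp (-2 * -u) = Real.exp u * Real.exp u := by rw [← Real.exp_add]; congr 1; ring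
    have e4 := Real.add_one_le_exp u
    have e5 : Real.exp (-s * -u) ≤ Real.exp u := Real.exp_le_exp.mpr (by nlinarith)
    have e6 := Real.exp_pos (-s * -u)
    rw [← e1, e3]
    have e7 : u * Real.exp (-s * -u) ≤ Real.exp u * Real.exp u := by
      apply mul_le_mul <;> nlinarith [Real.exp_pos u]
    nlinarith
  · have h1 : negExp y = 0 := by simp [negExp, hy]
    rw [h1, abs_of_nonneg (not_lt.mp hy)]; simp

open Classical in
noncomputable def psi (ζ s K x : ℝ) : ℝ :=
  Real.exp (-s * |x|) + s * K * (stripA ζ).indicator 1 x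

lemma psi_meas (ζ s K : ℝ) : Measurable (psi ζ s K) := by
  unfold psi
  apply Measurable.add (by fun_prop)
  exact (measurable_const.mul ((measurable_one).indicator (stripA_meas ζ)))

lemma psi_le (ζ s K x : ℝ) (hs : 0 ≤ s) (hK : 0 ≤ K) : psi ζ s K x ≤ 1 + s * K := by
  unfold psi
  have h1 : Real.exp (-s * |x|) ≤ 1 := Real.exp_le_one_iff.mpr (by nlinarith [abs_nonneg x])
  have h2 : (stripA ζ).indicator (1 : ℝ → ℝ) x ≤ 1 := Set.indicator_le_self' (by simp) x
  nlinarith [mul_nonneg hs hK]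

lemma psi_nonneg (ζ s K x : ℝ) (hs : 0 ≤ s) (hK : 0 ≤ K) : 0 ≤ psi ζ s K x := by
  unfold psi
  have h2 : 0 ≤ (stripA ζ).indicator (1 : ℝ → ℝ) x := Set.indicator_nonneg (by simp) x
  positivity

lemma psi_int (ζ s K : ℝ) (hs : 0 ≤ s) (hK : 0 ≤ K) (μ : Measure ℝ) [IsFiniteMeasure μ] :
    Integrable (psi ζ s K) μ := by
  refine Integrable.of_bound (psi_meas ζ s K).aestronglyMeasurable (1 + s * K) (ae_of_all _ fun x => ?_)
  rw [Real.norm_of_nonneg (psi_nonneg _ _ _ _ hs hK)]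
  exact psi_le _ _ _ _ hs hK

noncomputable def KK (ζ : ℝ) : ℝ := 200 * Real.exp 2 / (1 - 2 * ζ)

lemma psi_sub_pos (ζ : ℝ) (hζ0 : 0 < ζ) (hζ : ζ < 1 / 2) (s x : ℝ) (hs : 0 ≤ s) (hs1 : s ≤ 1)
    (hx : 0 ≤ x) :
    Real.exp (-s * |x|) ≤ Real.exp (-(s ^ 2 / 2)) * ∫ y, psi ζ s (KK ζ) y ∂(gaussianReal x 1) := by
  have hK : 0 ≤ KK ζ := by unfold KK; have : 0 < 1 - 2 * ζ := by linarith
                           positivity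
  have h0 := negExp_bound ζ hζ0 hζ x hx
  have hi2 : Integrable (fun y => s * KK ζ * (stripA ζ).indicator (1 : ℝ → ℝ) y) (gaussianReal x 1) :=
    ((integrable_const (1:ℝ)).indicator (stripA_meas ζ)).const_mul _
  have h1 : ∫ y, (Real.exp (-s * y) - 2 * s * negExp y
      + s * KK ζ * (stripA ζ).indicator (1 : ℝ → ℝ) y) ∂(gaussianReal x 1)
      ≤ ∫ y, psi ζ s (KK ζ) y ∂(gaussianReal x 1) := by
    apply integral_mono _ (psi_int ζ s _ hs hK _)
    · intro y
      have := exp_abs_lower s y hs hs1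
      simp only [psi]; linarith
    · exact ((exp_int x (-s)).sub ((negExp_int x).const_mul _)).add hi2
  have hi3 : Integrable (fun y => Real.exp (-s * y) - 2 * s * negExp y) (gaussianReal x 1) :=
    (exp_int x (-s)).sub ((negExp_int x).const_mul _)
  rw [integral_add hi3 hi2,
    integral_sub (exp_int x (-s)) ((negExp_int x).const_mul _), integral_const_mul,
    integral_const_mul, integral_indicator_one (stripA_meas ζ), exp_integral] at h1
  have h2 : 2 * ∫ y, negExp y ∂(gaussianReal x 1) ≤ KK ζ * (gaussianReal x 1).real (stripA ζ) := by
    unfold KK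
    have : 0 < 1 - 2 * ζ := by linarith
    rw [div_mul_eq_mul_div, le_div_iff₀ this]
    linarith
  have h3 : Real.exp (x * -s + (-s) ^ 2 / 2) ≤ ∫ y, psi ζ s (KK ζ) y ∂(gaussianReal x 1) := by
    nlinarith [mul_le_mul_of_nonneg_left h2 hs]
  calc Real.exp (-s * |x|) = Real.exp (-(s ^ 2 / 2)) * Real.exp (x * -s + (-s) ^ 2 / 2) := by
        rw [← Real.exp_add, abs_of_nonneg hx]; congr 1; ring
    _ ≤ _ := by gcongr

lemma psi_sub (ζ : ℝ) (hζ0 : 0 < ζ) (hζ : ζ < 1 / 2) (s x : ℝ) (hs : 0 ≤ s) (hs1 : s ≤ 1) :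
    Real.exp (-s * |x|) ≤ Real.exp (-(s ^ 2 / 2)) * ∫ y, psi ζ s (KK ζ) y ∂(gaussianReal x 1) := by
  rcases le_total 0 x with hx | hx
  · exact psi_sub_pos ζ hζ0 hζ s x hs hs1 hx
  · have := psi_sub_pos ζ hζ0 hζ s (-x) hs hs1 (by linarith)
    rw [abs_neg] at this
    have e : gaussianReal (-x) 1 = (gaussianReal x 1).map (fun y => -y) :=
      gaussianReal_map_neg.symm
    rw [e, integral_map (by fun_prop) (psi_meas _ _ _).aestronglyMeasurable] at this
    convert this using 4 with y
    simp [psi, stripA, Set.indicator]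

/-- the supersolution -/
noncomputable def vv (ζ s κ x : ℝ) : ℝ := 1 - κ * psi ζ s (KK ζ) x

open Classical in
noncomputable def gg (ζ δ x : ℝ) : ℝ := if x ∈ stripA ζ then 1 - δ else 1

lemma gg_meas (ζ δ : ℝ) : Measurable (gg ζ δ) :=
  Measurable.ite (stripA_meas ζ) measurable_const measurable_const

lemma KK_nonneg (ζ : ℝ) (hζ : ζ < 1 / 2) : 0 ≤ KK ζ := by
  unfold KK
  have : 0 < 1 - 2 * ζ := by linarith
  positivity

lemma vv_super (ζ : ℝ) (hζ0 : 0 < ζ) (hζ : ζ < 1 / 2) (s δ κ x : ℝ) (hs : 0 ≤ s) (hs1 : s ≤ 1)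
    (hδ : 0 < δ) (hδ1 : δ ≤ 1) (hκ0 : 0 ≤ κ)
    (hκ : κ * (1 + s * KK ζ + s * KK ζ / δ) = 1) :
    gg ζ δ x * ((1 - Real.exp (-(s ^ 2 / 2))) + Real.exp (-(s ^ 2 / 2)) *
      ∫ y, vv ζ s κ y ∂(gaussianReal x 1)) ≤ vv ζ s κ x := by
  have hK := KK_nonneg ζ hζ
  have h := psi_sub ζ hζ0 hζ s x hs hs1
  have hI : ∫ y, vv ζ s κ y ∂(gaussianReal x 1) = 1 - κ * ∫ y, psi ζ s (KK ζ) y ∂(gaussianReal x 1) := by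
    unfold vv
    rw [integral_sub (integrable_const _) ((psi_int ζ s _ hs hK _).const_mul _), integral_const_mul]
    simp
  rw [hI]
  set I := ∫ y, psi ζ s (KK ζ) y ∂(gaussianReal x 1)
  set r := Real.exp (-(s ^ 2 / 2))
  have hmul := mul_le_mul_of_nonneg_left h hκ0
  by_cases hx : x ∈ stripA ζ
  · have hp : psi ζ s (KK ζ) x = Real.exp (-s * |x|) + s * KK ζ := by simp [psi, hx]
    have hp1 := psi_le ζ s (KK ζ) x hs hK
    simp only [vv, gg, hx, if_true]
    rw [hp] at hp1 ⊢
    have hφ := mul_le_mul_of_nonneg_left hp1 hκ0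
    set φ := Real.exp (-s * |x|)
    set T := s * KK ζ with hT
    have hT0 : 0 ≤ T := mul_nonneg hs hK
    have hd : κ * (T / δ) ≤ 1 - κ * (φ + T) := by nlinarith
    have hd2 : κ * T ≤ δ * (1 - κ * (φ + T)) := by
      have := mul_le_mul_of_nonneg_left hd hδ.le
      calc κ * T = δ * (κ * (T / δ)) := by field_simp
        _ ≤ _ := this
    have : (1 - δ) * (κ * φ) ≤ (1 - δ) * (κ * (r * I)) :=
      mul_le_mul_of_nonneg_left hmul (by linarith)
    nlinarith [mul_nonneg (mul_nonneg hκ0 hT0) hδ.le]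
  · have hp : psi ζ s (KK ζ) x = Real.exp (-s * |x|) := by simp [psi, hx]
    simp only [vv, gg, hx, if_false]
    rw [hp]
    nlinarith

/-- Weight `∏_{i<n} g(B_{γ+i})`. -/
noncomputable def WW {Ω : Type} (ζ δ γ : ℝ) (B : ℝ → Ω → ℝ) (n : ℕ) (ω : Ω) : ℝ :=
  ∏ i ∈ Finset.range n, gg ζ δ (B (γ + i) ω)

lemma gg_nonneg (ζ δ x : ℝ) (hδ1 : δ ≤ 1) : 0 ≤ gg ζ δ x := by
  unfold gg; split_ifs <;> linarith

lemma gg_le (ζ δ x : ℝ) (hδ : 0 ≤ δ) : gg ζ δ x ≤ 1 := by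
  unfold gg; split_ifs <;> linarith

section prob
variable {Ω : Type} [MeasurableSpace Ω] {P : Measure Ω} {B : ℝ → Ω → ℝ}

lemma WW_nonneg (ζ δ γ : ℝ) (hδ1 : δ ≤ 1) (n : ℕ) (ω : Ω) : 0 ≤ WW ζ δ γ B n ω :=
  Finset.prod_nonneg fun _ _ => gg_nonneg _ _ _ hδ1

lemma WW_le (ζ δ γ : ℝ) (hδ : 0 ≤ δ) (hδ1 : δ ≤ 1) (n : ℕ) (ω : Ω) : WW ζ δ γ B n ω ≤ 1 :=
  Finset.prod_le_one (fun _ _ => gg_nonneg _ _ _ hδ1) (fun _ _ => gg_le _ _ _ hδ)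

lemma WW_meas (hB : IsStdBrownianMotion P B) (ζ δ γ : ℝ) (n : ℕ) :
    Measurable (WW ζ δ γ B n) := by
  unfold WW
  exact Finset.measurable_fun_prod _ fun i _ => (gg_meas ζ δ).comp (hB.meas _)

lemma bdd_int [IsFiniteMeasure P] (f : Ω → ℝ) (hf : Measurable f) (h0 : ∀ ω, 0 ≤ f ω)
    (h1 : ∀ ω, f ω ≤ 1) : Integrable f P := by
  refine Integrable.of_bound hf.aestronglyMeasurable 1 (ae_of_all _ fun x => ?_)
  rw [Real.norm_of_nonneg (h0 x)]; exact h1 x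

/-- Markov property. -/
lemma markov_step (hB : IsStdBrownianMotion P B) (ζ δ γ : ℝ) (hγ : 0 ≤ γ) (hδ : 0 ≤ δ)
    (hδ1 : δ ≤ 1) (n : ℕ) (v : ℝ → ℝ) (hv : Measurable v) (hv0 : ∀ x, 0 ≤ v x)
    (hv1 : ∀ x, v x ≤ 1) :
    ∫ ω, WW ζ δ γ B (n + 1) ω * v (B (γ + (n + 1 : ℕ)) ω) ∂P =
      ∫ ω, WW ζ δ γ B (n + 1) ω * ∫ y, v y ∂(gaussianReal (B (γ + n) ω) 1) ∂P := by
  have := hB.isProb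
  set X : Ω → ℝ × ℝ := fun ω => (WW ζ δ γ B (n + 1) ω, B (γ + n) ω) with hX
  set Z : Ω → ℝ := fun ω => B (γ + (n + 1 : ℕ)) ω - B (γ + n) ω with hZ
  have hXm : Measurable X := (WW_meas hB _ _ _ _).prodMk (hB.meas _)
  have hZm : Measurable Z := (hB.meas _).sub (hB.meas _)
  have hn : (0:ℝ) ≤ n := Nat.cast_nonneg n
  have hle : γ + (n:ℝ) ≤ γ + (n + 1 : ℕ) := by push_cast; linarith
  have hlaw : P.map Z = gaussianReal 0 1 := by
    rw [hZ, hB.incr _ _ (by linarith) hle]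
    congr 1
    push_cast
    rw [show γ + ((n:ℝ) + 1) - (γ + n) = 1 by ring]; simp
  have hind : IndepFun X Z P := by
    rw [IndepFun_iff_Indep]
    refine indep_of_indep_of_le_left (hB.indep _ _ (by linarith) hle) ?_
    set m : MeasurableSpace Ω :=
      ⨆ r ∈ Set.Icc (0 : ℝ) (γ + n), MeasurableSpace.comap (B r) inferInstance with hm
    have hBm : ∀ r ∈ Set.Icc (0 : ℝ) (γ + n), Measurable[m] (B r) := by
      intro r hr
      have h1 : MeasurableSpace.comap (B r) inferInstance ≤ m :=
        le_iSup₂ (f := fun r (_ : r ∈ Set.Icc (0 : ℝ) (γ + n)) =>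
          MeasurableSpace.comap (B r) inferInstance) r hr
      exact measurable_iff_comap_le.mpr h1
    have : Measurable[m] X := by
      refine Measurable.prodMk (m := m) ?_ (hBm _ ⟨by linarith, le_rfl⟩)
      unfold WW
      refine Finset.measurable_fun_prod _ fun i hi => (gg_meas ζ δ).comp (hBm _ ⟨?_, ?_⟩)
      · positivity
      · have : i ≤ n := Nat.lt_succ_iff.mp (Finset.mem_range.mp hi)
        have : (i:ℝ) ≤ n := by exact_mod_cast this
        linarith
    exact measurable_iff_comap_le.mp this
  have hprod := (indepFun_iff_map_prod_eq_prod_map_map hXm.aemeasurable hZm.aemeasurable).mp hind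
  set F : (ℝ × ℝ) × ℝ → ℝ := fun p => p.1.1 * v (p.1.2 + p.2) with hF
  have hFm : Measurable F := by
    apply Measurable.mul (by fun_prop)
    exact hv.comp (by fun_prop)
  have h1 : ∫ ω, WW ζ δ γ B (n + 1) ω * v (B (γ + (n + 1 : ℕ)) ω) ∂P =
      ∫ p, F p ∂((P.map X).prod (P.map Z)) := by
    rw [← hprod, integral_map (hXm.prodMk hZm).aemeasurable hFm.aestronglyMeasurable]
    simp [hF, hX, hZ]
  have := Measure.isProbabilityMeasure_map (μ := P) hXm.aemeasurable
  have := Measure.isProbabilityMeasure_map (μ := P) hZm.aemeasurable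
  have hFi : Integrable F ((P.map X).prod (P.map Z)) := by
    rw [← hprod, integrable_map_measure hFm.aestronglyMeasurable (hXm.prodMk hZm).aemeasurable]
    apply bdd_int _ (hFm.comp (hXm.prodMk hZm))
    · intro ω; exact mul_nonneg (WW_nonneg _ _ _ hδ1 _ _) (hv0 _)
    · intro ω; exact mul_le_one₀ (WW_le _ _ _ hδ hδ1 _ _) (hv0 _) (hv1 _)
  rw [h1, integral_prod _ hFi, integral_map hXm.aemeasurable
    hFi.aestronglyMeasurable.integral_prod_right']
  congr 1 with ω
  simp only [hF, hX]
  rw [integral_const_mul, hlaw]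
  congr 1
  have e : gaussianReal (B (γ + n) ω) 1 = (gaussianReal 0 1).map (fun z => B (γ + n) ω + z) := by
    rw [gaussianReal_map_const_add]; simp
  rw [e, integral_map (by fun_prop) hv.aestronglyMeasurable]

lemma vv_meas (ζ s κ : ℝ) : Measurable (vv ζ s κ) :=
  measurable_const.sub ((psi_meas _ _ _).const_mul _)

lemma main_iter (hB : IsStdBrownianMotion P B) (ζ : ℝ) (hζ0 : 0 < ζ) (hζ : ζ < 1 / 2)
    (γ s δ κ : ℝ) (hγ : 0 ≤ γ) (hs : 0 ≤ s) (hs1 : s ≤ 1)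
    (hδ : 0 < δ) (hδ1 : δ ≤ 1) (hκ0 : 0 ≤ κ)
    (hκ : κ * (1 + s * KK ζ + s * KK ζ / δ) = 1) (n : ℕ) :
    (1 - Real.exp (-(s ^ 2 / 2)) ^ n) * ∫ ω, WW ζ δ γ B n ω ∂P ≤
      ∫ ω, vv ζ s κ (B γ ω) ∂P := by
  have := hB.isProb
  have hK := KK_nonneg ζ hζ
  have hv0 : ∀ x, 0 ≤ vv ζ s κ x := by
    intro x
    have h1 := mul_le_mul_of_nonneg_left (psi_le ζ s (KK ζ) x hs hK) hκ0
    have h2 : 0 ≤ κ * (s * KK ζ / δ) := by positivity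
    unfold vv; nlinarith
  have hv1 : ∀ x, vv ζ s κ x ≤ 1 := by
    intro x
    have := mul_nonneg hκ0 (psi_nonneg ζ s (KK ζ) x hs hK)
    unfold vv; linarith
  have hsup := fun x => vv_super ζ hζ0 hζ s δ κ x hs hs1 hδ hδ1 hκ0 hκ
  set r := Real.exp (-(s ^ 2 / 2)) with hr
  have hr0 : 0 ≤ r := (Real.exp_pos _).le
  have hr1 : r ≤ 1 := Real.exp_le_one_iff.mpr (by nlinarith [sq_nonneg s])
  have hWi : ∀ n, Integrable (WW ζ δ γ B n) P := fun n =>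
    bdd_int _ (WW_meas hB _ _ _ _) (WW_nonneg _ _ _ hδ1 _) (WW_le _ _ _ hδ.le hδ1 _)
  have hWf : ∀ (n : ℕ) (f : ℝ → ℝ) (t : ℝ), Measurable f → (∀ x, 0 ≤ f x) → (∀ x, f x ≤ 1) →
      Integrable (fun ω => WW ζ δ γ B n ω * f (B t ω)) P := fun n f t hf h0 h1 =>
    bdd_int _ ((WW_meas hB _ _ _ _).mul (hf.comp (hB.meas _)))
      (fun ω => mul_nonneg (WW_nonneg _ _ _ hδ1 _ _) (h0 _))
      (fun ω => mul_le_one₀ (WW_le _ _ _ hδ.le hδ1 _ _) (h0 _) (h1 _))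
  -- averaged function
  set Q : ℝ → ℝ := fun x => ∫ y, vv ζ s κ y ∂(gaussianReal x 1) with hQ
  have hQm : Measurable Q := by
    have : Q = fun x => ∫ z, vv ζ s κ (x + z) ∂(gaussianReal 0 1) := by
      funext x
      have e : gaussianReal x 1 = (gaussianReal 0 1).map (fun z => x + z) := by
        rw [gaussianReal_map_const_add]; simp
      rw [hQ]; simp only
      rw [e, integral_map (by fun_prop) (vv_meas _ _ _).aestronglyMeasurable]
    rw [this]
    have hm : Measurable (fun p : ℝ × ℝ => vv ζ s κ (p.1 + p.2)) :=
      (vv_meas ζ s κ).comp (by fun_prop)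
    exact (hm.stronglyMeasurable.integral_prod_right').measurable
  have hQ0 : ∀ x, 0 ≤ Q x := fun x => integral_nonneg hv0
  have hQ1 : ∀ x, Q x ≤ 1 := by
    intro x
    calc Q x ≤ ∫ y, (1:ℝ) ∂(gaussianReal x 1) :=
          integral_mono (bdd_int _ (vv_meas _ _ _) hv0 hv1) (integrable_const _) hv1
      _ = 1 := by simp
  set b : ℕ → ℝ := fun n => ∫ ω, WW ζ δ γ B n ω ∂P with hb
  set c : ℕ → ℝ := fun n => ∫ ω, WW ζ δ γ B n ω * vv ζ s κ (B (γ + n) ω) ∂P with hc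
  have hbanti : ∀ n, b (n + 1) ≤ b n := by
    intro n
    apply integral_mono (hWi _) (hWi _)
    intro ω
    simp only [WW, Finset.prod_range_succ]
    exact mul_le_of_le_one_right (WW_nonneg _ _ _ hδ1 _ _) (gg_le _ _ _ hδ.le)
  have hstep : ∀ n, (1 - r) * b (n + 1) + r * c (n + 1) ≤ c n := by
    intro n
    have e : c (n + 1) = ∫ ω, WW ζ δ γ B (n + 1) ω * Q (B (γ + n) ω) ∂P :=
      markov_step hB ζ δ γ hγ hδ.le hδ1 n _ (vv_meas _ _ _) hv0 hv1
    have i2 := hWf (n + 1) Q (γ + n) hQm hQ0 hQ1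
    rw [e, hb]
    simp only
    rw [← integral_const_mul, ← integral_const_mul,
      ← integral_add ((hWi _).const_mul _) (i2.const_mul _)]
    apply integral_mono (((hWi _).const_mul _).add (i2.const_mul _)) (hWf n _ _ (vv_meas _ _ _) hv0 hv1)
    intro ω
    have h1 := mul_le_mul_of_nonneg_left (hsup (B (γ + n) ω)) (WW_nonneg ζ δ γ hδ1 n ω (B := B))
    have h2 : WW ζ δ γ B (n + 1) ω = WW ζ δ γ B n ω * gg ζ δ (B (γ + n) ω) := by
      simp only [WW, Finset.prod_range_succ]
    simp only [hQ, Pi.add_apply]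
    rw [h2]
    linarith
  have hc0 : ∀ n, 0 ≤ c n := fun n =>
    integral_nonneg fun ω => mul_nonneg (WW_nonneg _ _ _ hδ1 _ _) (hv0 _)
  have hind : ∀ n, (1 - r ^ n) * b n + r ^ n * c n ≤ c 0 := by
    intro n
    induction n with
    | zero => simp
    | succ n ih =>
      have hrn : 0 ≤ r ^ n := pow_nonneg hr0 n
      have hrn1 : r ^ n ≤ 1 := pow_le_one₀ hr0 hr1
      have h1 := mul_le_mul_of_nonneg_left (hstep n) hrn
      have h2 := mul_le_mul_of_nonneg_left (hbanti n) (sub_nonneg.mpr hrn1)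
      rw [pow_succ]
      nlinarith
  have hc00 : c 0 = ∫ ω, vv ζ s κ (B γ ω) ∂P := by simp [hc, WW]
  rw [← hc00]
  have := mul_nonneg (pow_nonneg hr0 n) (hc0 n)
  linarith [hind n]

lemma start_bound (hB : IsStdBrownianMotion P B) (ζ : ℝ) (hζ : ζ < 1 / 2)
    (γ s δ κ : ℝ) (hγ : 0 ≤ γ) (hγ1 : γ < 1) (hs : 0 ≤ s)
    (hδ : 0 < δ) (hκ0 : 0 ≤ κ)
    (hκ : κ * (1 + s * KK ζ + s * KK ζ / δ) = 1) :
    ∫ ω, vv ζ s κ (B γ ω) ∂P ≤ s * KK ζ + s * KK ζ / δ + s := by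
  have := hB.isProb
  have hK := KK_nonneg ζ hζ
  have hT : 0 ≤ s * KK ζ := by positivity
  have hT2 : 0 ≤ s * KK ζ / δ := by positivity
  have hκ1 : κ ≤ 1 := by nlinarith [mul_nonneg hκ0 hT, mul_nonneg hκ0 hT2]
  have hlaw : P.map (B γ) = gaussianReal 0 (Real.toNNReal γ) := by
    have := hB.incr 0 γ le_rfl hγ
    rw [sub_zero] at this
    rw [← this]
    apply Measure.map_congr
    filter_upwards [hB.init] with ω hω
    simp [hω]
  -- second moment
  have hsq : Integrable (fun x : ℝ => x ^ 2) (gaussianReal 0 (Real.toNNReal γ)) :=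
    (memLp_id_gaussianReal' 2 (by simp)).integrable_sq
  have hsqv : ∫ x, x ^ 2 ∂(gaussianReal 0 (Real.toNNReal γ)) = γ := by
    have h := variance_id_gaussianReal (μ := 0) (v := Real.toNNReal γ)
    rw [variance_of_integral_eq_zero (by fun_prop) (by simp)] at h
    simpa [hγ] using h
  have hle : ∀ x, vv ζ s κ x ≤ s * KK ζ + s * KK ζ / δ + s * (1 / 2 + x ^ 2 / 2) := by
    intro x
    have h1 : 1 - s * |x| ≤ psi ζ s (KK ζ) x := by
      have h2 : 0 ≤ (stripA ζ).indicator (1 : ℝ → ℝ) x := Set.indicator_nonneg (by simp) x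
      have := Real.add_one_le_exp (-s * |x|)
      unfold psi
      nlinarith [mul_nonneg hT h2]
    have h2 := mul_le_mul_of_nonneg_left h1 hκ0
    have h3 : |x| ≤ 1 / 2 + x ^ 2 / 2 := by
      nlinarith [sq_nonneg (|x| - 1), sq_abs x]
    have h4 := mul_le_mul_of_nonneg_left h3 hs
    have h5 : κ * (s * |x|) ≤ s * |x| := mul_le_of_le_one_left (by positivity) hκ1
    have h6 : κ * (s * KK ζ) ≤ s * KK ζ := mul_le_of_le_one_left hT hκ1
    have h7 : κ * (s * KK ζ / δ) ≤ s * KK ζ / δ := mul_le_of_le_one_left hT2 hκ1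
    unfold vv
    nlinarith
  have e : ∫ ω, vv ζ s κ (B γ ω) ∂P = ∫ x, vv ζ s κ x ∂(gaussianReal 0 (Real.toNNReal γ)) := by
    rw [← hlaw, integral_map (hB.meas _).aemeasurable (vv_meas _ _ _).aestronglyMeasurable]
  rw [e]
  have hi : Integrable (fun x : ℝ => s * KK ζ + s * KK ζ / δ + s * (1 / 2 + x ^ 2 / 2))
      (gaussianReal 0 (Real.toNNReal γ)) :=
    (integrable_const _).add (((integrable_const _).add (hsq.div_const 2)).const_mul s)
  have hi2 : Integrable (fun x : ℝ => 1 / 2 + x ^ 2 / 2)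
      (gaussianReal 0 (Real.toNNReal γ)) := (integrable_const _).add (hsq.div_const 2)
  calc _ ≤ ∫ x, (s * KK ζ + s * KK ζ / δ + s * (1 / 2 + x ^ 2 / 2))
          ∂(gaussianReal 0 (Real.toNNReal γ)) := by
        apply integral_mono _ hi hle
        exact (integrable_const _).sub ((psi_int ζ s _ hs hK _).const_mul _)
    _ = s * KK ζ + s * KK ζ / δ + s * (1 / 2 + γ / 2) := by
        rw [integral_add (integrable_const _) (hi2.const_mul s), integral_const_mul,
          integral_add (integrable_const _) (hsq.div_const 2), integral_div 2 (fun x : ℝ => x ^ 2), hsqv]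
        simp
    _ ≤ _ := by nlinarith

lemma WW_count (ζ δ γ : ℝ) (hδ : 0 ≤ δ) (hδ1 : δ ≤ 1) (J : ℕ) (ω : Ω) :
    1 - δ * (Set.ncard {j : ℕ | j ≤ J ∧ |B (γ + j) ω| ∈ Set.Icc (1 + ζ) (2 - ζ)} : ℝ)
      ≤ WW ζ δ γ B (J + 1) ω := by
  classical
  have e : {j : ℕ | j ≤ J ∧ |B (γ + j) ω| ∈ Set.Icc (1 + ζ) (2 - ζ)} =
      ↑((Finset.range (J + 1)).filter (fun j : ℕ => B (γ + j) ω ∈ stripA ζ)) := by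
    ext j
    simp [stripA]
  rw [e, Set.ncard_coe_finset]
  have e2 : WW ζ δ γ B (J + 1) ω =
      (1 - δ) ^ ((Finset.range (J + 1)).filter (fun j : ℕ => B (γ + j) ω ∈ stripA ζ)).card := by
    unfold WW gg
    rw [Finset.prod_ite]
    simp
  rw [e2]
  have := one_add_mul_le_pow (a := -δ) (by linarith)
    ((Finset.range (J + 1)).filter (fun j : ℕ => B (γ + j) ω ∈ stripA ζ)).card
  rw [← sub_eq_add_neg 1 δ] at this
  linarith

end prob

set_option maxHeartbeats 1000000

/-- For every `ζ ∈ (0, 1/2)` there are constants `c₁, c₂, c₃ > 0` depending only on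
`ζ` such that for every Brownian motion, every `η ∈ (0,1)`, every integer
`J ≥ c₁ ln(c₂/η)²/η²` and every `γ ∈ [0,1)`, the count
`N₊ = #{0 ≤ j ≤ J : |B_{γ+j}| ∈ [1+ζ, 2−ζ]}` satisfies `P(N₊ ≥ c₃ η √J) ≥ 1 − η`. -/
theorem brownian_strip_visit_count (ζ : ℝ) (hζ0 : 0 < ζ) (hζ : ζ < 1 / 2) :
    ∃ c₁ c₂ c₃ : ℝ, 0 < c₁ ∧ 0 < c₂ ∧ 0 < c₃ ∧
      ∀ (Ω : Type) (_ : MeasurableSpace Ω) (P : Measure Ω) (B : ℝ → Ω → ℝ),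
        IsStdBrownianMotion P B →
        ∀ η : ℝ, 0 < η → η < 1 →
        ∀ J : ℕ, c₁ * Real.log (c₂ / η) ^ 2 / η ^ 2 ≤ (J : ℝ) →
        ∀ γ : ℝ, 0 ≤ γ → γ < 1 →
          ENNReal.ofReal (1 - η) ≤
            P {ω | c₃ * η * Real.sqrt J ≤
              (Set.ncard {j : ℕ | j ≤ J ∧
                |B (γ + j) ω| ∈ Set.Icc (1 + ζ) (2 - ζ)} : ℝ)} := by
  have hK := KK_nonneg ζ hζ
  set K := KK ζ with hKdef
  have hc3 : 0 < 1 / (16 * (2 * K + 1)) := by positivity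
  refine ⟨(16 * (2 * K + 1)) ^ 2, Real.exp 1, 1 / (16 * (2 * K + 1)), by positivity,
    Real.exp_pos 1, hc3, ?_⟩
  intro Ω _ P B hB η hη hη1 J hJ γ hγ hγ1
  have := hB.isProb
  set D := 16 * (2 * K + 1) with hD
  have hD16 : 16 ≤ D := by linarith
  have hlog : 1 ≤ Real.log (Real.exp 1 / η) := by
    rw [Real.log_div (Real.exp_pos 1).ne' hη.ne', Real.log_exp]
    linarith [Real.log_nonpos hη.le hη1.le]
  have hJ1 : (D / η) ^ 2 ≤ J := by
    refine le_trans ?_ hJ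
    rw [div_pow]
    gcongr
    nlinarith [sq_nonneg D, one_le_pow₀ hlog (n := 2)]
  have hsq : D / η ≤ Real.sqrt J := Real.le_sqrt_of_sq_le hJ1
  have hDη : 16 ≤ D / η := by rw [le_div_iff₀ hη]; nlinarith
  have hS : 0 < Real.sqrt J := by linarith
  have hSS : Real.sqrt J ^ 2 = J := Real.sq_sqrt (Nat.cast_nonneg J)
  have hJ0 : (0:ℝ) < J := by rw [← hSS]; positivity
  set S := Real.sqrt J with hSdef
  set m := 1 / D * η * S with hm
  have hm1 : 1 ≤ m := by
    rw [div_le_iff₀ hη] at hsq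
    rw [hm, mul_assoc, div_mul_eq_mul_div, le_div_iff₀ (by linarith)]
    linarith
  -- parameters
  set δ := 1 / (2 * m) with hδdef
  have hδ : 0 < δ := by positivity
  have hδ1 : δ ≤ 1 := by rw [hδdef, div_le_one (by positivity)]; linarith
  set s := Real.sqrt 2 / S with hsdef
  have h2 : Real.sqrt 2 ≤ 2 := by
    rw [Real.sqrt_le_left (by norm_num)]; norm_num
  have h22 : Real.sqrt 2 ^ 2 = 2 := Real.sq_sqrt (by norm_num)
  have hs : 0 ≤ s := by positivity
  have hs1 : s ≤ 1 := by rw [hsdef, div_le_one hS]; linarith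
  set T := 1 + s * K + s * K / δ with hT
  have hTpos : 0 < T := by positivity
  have hit := main_iter hB ζ hζ0 hζ γ s δ (1 / T) hγ hs hs1 hδ hδ1 (by positivity)
    (by rw [← hKdef, ← hT]; field_simp) (J + 1)
  have hst := start_bound hB ζ hζ γ s δ (1 / T) hγ hγ1 hs hδ (by positivity)
    (by rw [← hKdef, ← hT]; field_simp)
  rw [← hKdef] at hst
  have hr : Real.exp (-(s ^ 2 / 2)) ^ (J + 1) ≤ 1 / 2 := by
    rw [← Real.exp_nat_mul]
    have e1 : s ^ 2 = 2 / J := by rw [hsdef, div_pow, h22, hSS]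
    have e2 : ((J + 1 : ℕ) : ℝ) * -(s ^ 2 / 2) ≤ -1 := by
      rw [e1]; push_cast
      have : ((J:ℝ) + 1) * -(2 / J / 2) = -1 - 1 / J := by field_simp; ring
      rw [this]
      have : 0 < 1 / (J:ℝ) := by positivity
      linarith
    calc _ ≤ Real.exp (-1) := Real.exp_le_exp.mpr e2
      _ ≤ 1 / 2 := by
        rw [Real.exp_neg, inv_eq_one_div]
        have := Real.add_one_le_exp (1:ℝ)
        exact one_div_le_one_div_of_le (by norm_num) (by linarith)
  set W := WW ζ δ γ B (J + 1) with hW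
  have hW0 : ∀ ω, 0 ≤ W ω := WW_nonneg _ _ _ hδ1 _
  have hWi : Integrable W P :=
    bdd_int _ (WW_meas hB _ _ _ _) hW0 (WW_le _ _ _ hδ.le hδ1 _)
  have hEW : ∫ ω, W ω ∂P ≤ 2 * (s * K + s * K / δ + s) := by
    have := integral_nonneg (μ := P) (f := W) hW0
    nlinarith
  have hmk := mul_meas_ge_le_integral_of_nonneg (ae_of_all P hW0) hWi (1 / 2)
  have hfin : 4 * (s * K + s * K / δ + s) ≤ η := by
    have e1 : s * K / δ = 2 * m * (s * K) := by rw [hδdef]; field_simp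
    have e2 : m * s = η * Real.sqrt 2 / D := by rw [hm, hsdef]; field_simp
    have e3 : s ≤ m * s := le_mul_of_one_le_left hs hm1
    have e4 : s * K + s * K / δ + s ≤ (3 * K + 1) * (m * s) := by
      rw [e1]; nlinarith [mul_le_mul_of_nonneg_right e3 hK]
    have e5 : (3 * K + 1) * (m * s) ≤ η / 4 := by
      rw [e2, ← mul_div_assoc, div_le_iff₀ (by linarith)]
      have : η * Real.sqrt 2 ≤ η * 2 := by gcongr
      have h3 : (3 * K + 1) * (η * Real.sqrt 2) ≤ (3 * K + 1) * (η * 2) := by gcongr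
      rw [hD]
      nlinarith [mul_nonneg hη.le hK]
    linarith
  have hbad : P.real {ω | 1 / 2 ≤ W ω} ≤ η := by linarith
  have hmeas : MeasurableSet {ω | 1 / 2 ≤ W ω} :=
    measurableSet_le measurable_const (WW_meas hB _ _ _ _)
  have hgood : 1 - η ≤ P.real {ω | 1 / 2 ≤ W ω}ᶜ := by
    rw [probReal_compl_eq_one_sub hmeas]; linarith
  calc ENNReal.ofReal (1 - η) ≤ ENNReal.ofReal (P.real {ω | 1 / 2 ≤ W ω}ᶜ) :=
        ENNReal.ofReal_le_ofReal hgood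
    _ = P {ω | 1 / 2 ≤ W ω}ᶜ := ENNReal.ofReal_toReal (measure_ne_top P _)
    _ ≤ _ := by
      apply measure_mono
      intro ω hω
      simp only [Set.mem_compl_iff, Set.mem_setOf_eq, not_le] at hω
      simp only [Set.mem_setOf_eq]
      have hcount := WW_count (B := B) ζ δ γ hδ.le hδ1 J ω
      by_contra hlt
      rw [not_le] at hlt
      have h3 := mul_lt_mul_of_pos_left hlt hδ
      have h4 : δ * m = 1 / 2 := by rw [hδdef]; field_simp
      linarith
end

section
/- Let (B_t)_{t≥0} be a standard one-dimensional Brownian motion. Define σ₁ := 0 and, recursively for i ≥ 1, τ_i := inf{ t > σ_i : B_t = 2 } and σ_{i+1} := inf{ t > τ_i : B_t = 0 } (these random times are almost surely finite). Then for every integer i₀ ≥ 1, the random variable τ_{i₀} has the same distribution as the hitting time inf{ t > 0 : B_t = 2(2 i₀ − 1) }. -/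
open MeasureTheory ProbabilityTheory Filter
open scoped NNReal

/-- The alternating sequence of hitting times of `2` and `0`: `sigTau B ω n = (σ_{n+1}, τ_{n+1})`
where `σ₁ = 0`, `τ_i = inf{t > σ_i : B_t = 2}` and `σ_{i+1} = inf{t > τ_i : B_t = 0}`. -/
noncomputable def sigTau {Ω : Type*} (B : ℝ → Ω → ℝ) (ω : Ω) : ℕ → ℝ × ℝ
  | 0 => (0, sInf {t : ℝ | 0 < t ∧ B t ω = 2})
  | n + 1 =>
    let σ := sInf {t : ℝ | (sigTau B ω n).2 < t ∧ B t ω = 0}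
    (σ, sInf {t : ℝ | σ < t ∧ B t ω = 2})

/-- The level sequence `0, a, 0, a, …`. -/
noncomputable def tgt (a : ℝ) (k : ℕ) : ℝ := if Odd k then a else 0

/-- `Alt x a k t`: the path `x` has completed `k` alternating passages before time `t`. -/
def Alt (x : ℝ → ℝ) (a : ℝ) : ℕ → ℝ → Prop
  | 0, t => 0 ≤ t
  | k + 1, t => ∃ r, Alt x a k r ∧ r ≤ t ∧ x r = tgt a (k + 1)

lemma tgt_ne {a : ℝ} (ha : 0 < a) (k : ℕ) : tgt a (k + 1) ≠ tgt a k := by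
  unfold tgt
  rcases Nat.even_or_odd k with h | h
  · have h1 : Odd (k + 1) := h.add_one
    have h2 : ¬ Odd k := by simpa using h
    simp [h1, h2, ha.ne']
  · have h1 : ¬ Odd (k + 1) := by simpa using h.add_one
    simp [h1, h, ha.ne]

lemma Alt.mono {x : ℝ → ℝ} {a : ℝ} {k : ℕ} {s t : ℝ} (h : Alt x a k s) (hst : s ≤ t) :
    Alt x a k t := by
  cases k with
  | zero => exact le_trans h hst
  | succ k =>
    obtain ⟨r, h1, h2, h3⟩ := h
    exact ⟨r, h1, h2.trans hst, h3⟩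

lemma Alt.pred {x : ℝ → ℝ} {a : ℝ} {k : ℕ} {t : ℝ} (h : Alt x a (k + 1) t) :
    Alt x a k t := by
  obtain ⟨r, h1, h2, h3⟩ := h
  exact h1.mono h2

lemma Alt.nonneg {x : ℝ → ℝ} {a : ℝ} {k : ℕ} {t : ℝ} (h : Alt x a k t) : 0 ≤ t := by
  induction k with
  | zero => exact h
  | succ k ih => exact ih h.pred

lemma Alt.exists_first {x : ℝ → ℝ} {a : ℝ} (hx : Continuous x) (h0 : x 0 = 0) {k : ℕ} {t : ℝ}
    (h : Alt x a k t) : ∃ T, x T = tgt a k ∧ ∀ s, Alt x a k s ↔ T ≤ s := by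
  induction k generalizing t with
  | zero => exact ⟨0, by simp [h0, tgt], fun s => Iff.rfl⟩
  | succ k ih =>
    obtain ⟨r, h1, h2, h3⟩ := h
    obtain ⟨T, hT, hTs⟩ := ih h1
    set S : Set ℝ := Set.Ici T ∩ x ⁻¹' {tgt a (k + 1)} with hS
    have hcl : IsClosed S := isClosed_Ici.inter (isClosed_singleton.preimage hx)
    have hne : S.Nonempty := ⟨r, (hTs r).1 h1, h3⟩
    have hbd : BddBelow S := ⟨T, fun y hy => hy.1⟩
    have hm := hcl.csInf_mem hne hbd
    refine ⟨sInf S, hm.2, fun s => ⟨?_, ?_⟩⟩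
    · rintro ⟨y, hy1, hy2, hy3⟩
      exact (csInf_le hbd ⟨(hTs y).1 hy1, hy3⟩).trans hy2
    · intro hs
      exact ⟨sInf S, (hTs _).2 hm.1, hs, hm.2⟩

/-- A countable description of `Alt`. -/
lemma alt_succ_iff {x : ℝ → ℝ} {a : ℝ} (ha : 0 < a) (hx : Continuous x) (h0 : x 0 = 0) (k : ℕ)
    {s : ℝ} (hs : 0 ≤ s) :
    Alt x a (k + 1) s ↔ ∀ n : ℕ, ∃ q : ℚ, Alt x a k (max 0 (min (q : ℝ) s)) ∧
      |x (max 0 (min (q : ℝ) s)) - tgt a (k + 1)| < 1 / ((n : ℝ) + 1) := by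
  constructor
  · rintro ⟨r, h1, h2, h3⟩ n
    obtain ⟨T, hT, hTs⟩ := h1.exists_first hx h0
    have hr0 : 0 ≤ r := h1.nonneg
    have hTr : T < r := by
      refine lt_of_le_of_ne ((hTs r).1 h1) ?_
      rintro rfl
      exact tgt_ne ha k (h3.symm.trans hT)
    have hr : max 0 (min r s) = r := by rw [min_eq_left h2, max_eq_right hr0]
    have hc : Continuous (fun y : ℝ => max 0 (min y s)) := by fun_prop
    have ho : IsOpen {y : ℝ | T < max 0 (min y s) ∧
        |x (max 0 (min y s)) - tgt a (k + 1)| < 1 / ((n : ℝ) + 1)} := by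
      refine (isOpen_lt continuous_const hc).and (isOpen_lt ?_ continuous_const)
      exact ((hx.comp hc).sub continuous_const).abs
    obtain ⟨q, hq⟩ := Rat.denseRange_cast.exists_mem_open ho
      ⟨r, by
        rw [Set.mem_ofPred_eq, hr, h3]
        refine ⟨hTr, ?_⟩
        simp only [sub_self, abs_zero]
        positivity⟩
    exact ⟨q, (hTs _).2 hq.1.le, hq.2⟩
  · intro h
    obtain ⟨q, hq, -⟩ := h 0
    obtain ⟨T, hT, hTs⟩ := hq.exists_first hx h0
    have hle : ∀ q : ℚ, max 0 (min (q : ℝ) s) ≤ s := fun q => max_le hs (min_le_right _ _)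
    obtain ⟨r, hr, hmin⟩ := (isCompact_Icc (a := T) (b := s)).exists_isMinOn
      ⟨_, (hTs _).1 hq, hle q⟩
      (f := fun y => |x y - tgt a (k + 1)|) (by fun_prop)
    refine ⟨r, (hTs _).2 hr.1, hr.2, ?_⟩
    have hz : |x r - tgt a (k + 1)| ≤ 0 := by
      by_contra! hpos
      obtain ⟨n, hn⟩ := exists_nat_one_div_lt hpos
      obtain ⟨q', hq', hlt⟩ := h n
      have := hmin (a := max 0 (min (q' : ℝ) s)) ⟨(hTs _).1 hq', hle q'⟩
      simp only [Set.mem_ofPred_eq] at this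
      linarith
    have := abs_nonpos_iff.1 hz
    linarith

open Classical in
/-- indicator of `Alt`. -/
noncomputable def altInd (x : ℝ → ℝ) (a : ℝ) (k : ℕ) (t : ℝ) : ℝ := if Alt x a k t then 1 else 0

/-- The path reflected at each of the first `K` passage times. -/
noncomputable def reflPath (x : ℝ → ℝ) (a : ℝ) (K : ℕ) (t : ℝ) : ℝ :=
  x t + ∑ k ∈ Finset.range K, 2 * (-1) ^ (k + 1) * (altInd x a (k + 1) t * (x t - tgt a (k + 1)))

/-- The sign attached to the reflected path. -/
noncomputable def sgn (x : ℝ → ℝ) (a : ℝ) (K : ℕ) (t : ℝ) : ℝ :=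
  1 + ∑ k ∈ Finset.range K, 2 * (-1) ^ (k + 1) * altInd x a (k + 1) t

lemma sgn_aux (x : ℝ → ℝ) (a : ℝ) (K : ℕ) (t : ℝ) :
    (Alt x a K t → sgn x a K t = (-1) ^ K) ∧ (sgn x a K t = 1 ∨ sgn x a K t = -1) := by
  induction K with
  | zero => simp [sgn]
  | succ K ih =>
    have hs : sgn x a (K + 1) t = sgn x a K t + 2 * (-1) ^ (K + 1) * altInd x a (K + 1) t := by
      simp only [sgn, Finset.sum_range_succ]; ring
    by_cases h : Alt x a (K + 1) t
    · have h1 : sgn x a (K + 1) t = (-1) ^ (K + 1) := by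
        rw [hs, ih.1 h.pred, altInd, if_pos h]; ring
      refine ⟨fun _ => h1, ?_⟩
      rw [h1]
      exact neg_one_pow_eq_or ℝ _
    · have h1 : sgn x a (K + 1) t = sgn x a K t := by
        rw [hs, altInd, if_neg h]; ring
      exact ⟨fun h' => absurd h' h, h1 ▸ ih.2⟩

lemma reflPath_succ (x : ℝ → ℝ) (a : ℝ) (K : ℕ) (t : ℝ) :
    reflPath x a (K + 1) t = reflPath x a K t +
      2 * (-1) ^ (K + 1) * (altInd x a (K + 1) t * (x t - tgt a (K + 1))) := by
  simp only [reflPath, Finset.sum_range_succ]; ring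

lemma reflPath_of_alt (x : ℝ → ℝ) (a : ℝ) (K : ℕ) (t : ℝ) (h : Alt x a K t) :
    (Even K → reflPath x a K t = x t + a * K) ∧ (Odd K → reflPath x a K t = - x t + a * (K + 1)) := by
  induction K with
  | zero => simp [reflPath]
  | succ K ih =>
    have ih := ih h.pred
    rw [reflPath_succ, altInd, if_pos h]
    constructor
    · intro he
      have ho : Odd K := by
        rcases Nat.even_or_odd K with h | h
        · exact absurd he (by simpa using h.add_one)
        · exact h
      rw [ih.2 ho, tgt, if_neg (by simpa using he), he.neg_one_pow]
      push_cast; ring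
    · intro ho
      have he : Even K := by
        rcases Nat.even_or_odd K with h | h
        · exact h
        · exact absurd ho (by simpa using h.add_one)
      rw [ih.1 he, tgt, if_pos ho, ho.neg_one_pow]
      push_cast; ring

lemma reflPath_succ_of_alt (x : ℝ → ℝ) (a : ℝ) (K : ℕ) (t : ℝ) (h : Alt x a (K + 1) t) :
    reflPath x a (K + 1) t = 2 * (a * (K + 1)) - reflPath x a K t := by
  have h1 := reflPath_of_alt x a _ t h
  have h2 := reflPath_of_alt x a _ t h.pred
  rcases Nat.even_or_odd K with hK | hK
  · rw [h1.2 hK.add_one, h2.1 hK]; push_cast; ring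
  · rw [h1.1 hK.add_one, h2.2 hK]; push_cast; ring

lemma reflPath_succ_of_not_alt (x : ℝ → ℝ) (a : ℝ) (K : ℕ) (t : ℝ) (h : ¬ Alt x a (K + 1) t) :
    reflPath x a (K + 1) t = reflPath x a K t := by
  rw [reflPath_succ, altInd, if_neg h]; ring

lemma reflPath_lt_aux {x : ℝ → ℝ} {a : ℝ} (ha : 0 < a) (hx : Continuous x) (h0 : x 0 = 0) (K : ℕ) (t : ℝ)
    (h : ¬ Alt x a (K + 1) t) (hK : Alt x a K t) : reflPath x a K t < a * (K + 1) := by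
  obtain ⟨T, hT, hTs⟩ := hK.exists_first hx h0
  have hTt := (hTs t).1 hK
  have hf := reflPath_of_alt x a _ t hK
  rcases Nat.even_or_odd K with hK' | hK'
  · rw [hf.1 hK']
    have h1 : x t < a := by
      by_contra! hge
      rw [tgt, if_neg (by simpa using hK')] at hT
      obtain ⟨r, hr, hr'⟩ := intermediate_value_Icc hTt hx.continuousOn
        (show a ∈ Set.Icc (x T) (x t) from ⟨by linarith, hge⟩)
      exact h ⟨r, (hTs r).2 hr.1, hr.2, by rw [hr', tgt, if_pos hK'.add_one]⟩
    linarith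
  · rw [hf.2 hK']
    have h1 : 0 < x t := by
      by_contra! hge
      rw [tgt, if_pos hK'] at hT
      obtain ⟨r, hr, hr'⟩ := intermediate_value_Icc' hTt hx.continuousOn
        (show 0 ∈ Set.Icc (x t) (x T) from ⟨hge, by linarith⟩)
      exact h ⟨r, (hTs r).2 hr.1, hr.2, by
        rw [hr', tgt, if_neg (by simpa using hK'.add_one)]⟩
    linarith

lemma reflPath_lt {x : ℝ → ℝ} {a : ℝ} (ha : 0 < a) (hx : Continuous x) (h0 : x 0 = 0) (K : ℕ)
    (t : ℝ) (ht : 0 ≤ t) (h : ¬ Alt x a (K + 1) t) : reflPath x a K t < a * (K + 1) := by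
  induction K with
  | zero => exact reflPath_lt_aux ha hx h0 0 t h ht
  | succ K ih =>
    by_cases hK : Alt x a (K + 1) t
    · exact reflPath_lt_aux ha hx h0 _ t h hK
    · rw [reflPath_succ_of_not_alt _ _ _ _ hK]
      have := ih hK
      push_cast
      linarith

open Topology in
lemma altInd_sum_tendsto {x : ℝ → ℝ} {a : ℝ} (hx : Continuous x) (h0 : x 0 = 0)
    (k : ℕ) {t : ℝ} (ht : 0 < t) :
    Tendsto (fun n : ℕ => ∑ j ∈ Finset.range n, altInd x a k (t * ((j : ℝ) / n)) *
      (x (t * (((j + 1 : ℕ) : ℝ) / n)) - x (t * ((j : ℝ) / n)))) atTop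
      (𝓝 (altInd x a k t * (x t - tgt a k))) := by
  by_cases h : Alt x a k t
  · obtain ⟨T, hT, hTs⟩ := h.exists_first hx h0
    have hT0 : 0 ≤ T := ((hTs T).2 le_rfl).nonneg
    have hTt : T ≤ t := (hTs t).1 h
    have hlim : Tendsto (fun n : ℕ => x t - x (t * ((⌈T / t * (n : ℝ)⌉₊ : ℝ) / (n : ℝ)))) atTop
        (𝓝 (altInd x a k t * (x t - tgt a k))) := by
      have h1 : Tendsto (fun n : ℕ => ((⌈T / t * (n : ℝ)⌉₊ : ℝ) / (n : ℝ))) atTop (𝓝 (T / t)) :=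
        (tendsto_nat_ceil_mul_div_atTop (div_nonneg hT0 ht.le)).comp tendsto_natCast_atTop_atTop
      have h2 := (hx.tendsto _).comp (h1.const_mul t)
      rw [mul_div_cancel₀ _ ht.ne', hT] at h2
      rw [altInd, if_pos h, one_mul]
      exact h2.const_sub (x t)
    refine hlim.congr' ?_
    filter_upwards [eventually_ge_atTop 1] with n hn
    have hn0 : (0 : ℝ) < n := by exact_mod_cast hn
    have hiff : ∀ j : ℕ, Alt x a k (t * ((j : ℝ) / n)) ↔ ⌈T / t * (n : ℝ)⌉₊ ≤ j := by
      intro j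
      rw [hTs, Nat.ceil_le, div_mul_eq_mul_div, div_le_iff₀ ht, ← mul_div_assoc, le_div_iff₀ hn0,
        mul_comm t]
    have hle : ⌈T / t * (n : ℝ)⌉₊ ≤ n := by
      rw [Nat.ceil_le]
      have : T / t ≤ 1 := (div_le_one ht).2 hTt
      nlinarith
    have hfil : (Finset.range n).filter (fun j => ⌈T / t * (n : ℝ)⌉₊ ≤ j) =
        Finset.Ico ⌈T / t * (n : ℝ)⌉₊ n := by
      ext j; simp; tauto
    simp only [altInd, hiff, ite_mul, one_mul, zero_mul]
    rw [← Finset.sum_filter, hfil,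
      Finset.sum_Ico_sub (fun j : ℕ => x (t * ((j : ℝ) / n))) hle, div_self hn0.ne', mul_one]
  · have : ∀ n : ℕ, ∑ j ∈ Finset.range n, altInd x a k (t * ((j : ℝ) / n)) *
      (x (t * (((j + 1 : ℕ) : ℝ) / n)) - x (t * ((j : ℝ) / n))) = 0 := by
      intro n
      refine Finset.sum_eq_zero fun j hj => ?_
      have hj' : (j : ℝ) < n := by exact_mod_cast Finset.mem_range.1 hj
      have hn0 : (0 : ℝ) < n := lt_of_le_of_lt (Nat.cast_nonneg j) hj'
      have : ¬ Alt x a k (t * ((j : ℝ) / n)) := fun h' => h (h'.mono (by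
        have : (j : ℝ) / n ≤ 1 := (div_le_one hn0).2 hj'.le
        nlinarith))
      rw [altInd, if_neg this, zero_mul]
    simp only [this]
    rw [altInd, if_neg h, zero_mul]
    exact tendsto_const_nhds

open Topology in
lemma sgn_sum_tendsto {x : ℝ → ℝ} {a : ℝ} (hx : Continuous x) (h0 : x 0 = 0)
    (K : ℕ) {t : ℝ} (ht : 0 < t) :
    Tendsto (fun n : ℕ => ∑ j ∈ Finset.range n, sgn x a K (t * ((j : ℝ) / n)) *
      (x (t * (((j + 1 : ℕ) : ℝ) / n)) - x (t * ((j : ℝ) / n)))) atTop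
      (𝓝 (reflPath x a K t)) := by
  have h1 : Tendsto (fun n : ℕ => x t + ∑ k ∈ Finset.range K, 2 * (-1) ^ (k + 1) *
      ∑ j ∈ Finset.range n, altInd x a (k + 1) (t * ((j : ℝ) / n)) *
      (x (t * (((j + 1 : ℕ) : ℝ) / n)) - x (t * ((j : ℝ) / n)))) atTop
      (𝓝 (reflPath x a K t)) := by
    refine tendsto_const_nhds.add (tendsto_finsetSum _ fun k _ => ?_)
    exact (altInd_sum_tendsto hx h0 (k + 1) ht).const_mul _
  refine h1.congr' ?_
  filter_upwards [eventually_ge_atTop 1] with n hn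
  have hn0 : (0 : ℝ) < n := by exact_mod_cast hn
  simp only [sgn, add_mul, one_mul, Finset.sum_add_distrib]
  congr 1
  · rw [Finset.sum_range_sub (fun j : ℕ => x (t * ((j : ℝ) / n))), div_self hn0.ne']
    simp [h0]
  · simp only [Finset.mul_sum, Finset.sum_mul]
    rw [Finset.sum_comm]
    refine Finset.sum_congr rfl fun j _ => Finset.sum_congr rfl fun k _ => ?_
    ring

lemma charStep {Ω : Type*} {m m0 : MeasurableSpace Ω} {P : Measure Ω} [IsProbabilityMeasure P]
    (hm : m ≤ m0) {S ε X : Ω → ℝ} (hS : Measurable[m] S)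
    (hε : Measurable[m] ε) (hε1 : ∀ ω, ε ω = 1 ∨ ε ω = -1) (hX : Measurable X) {v : ℝ≥0}
    (hlaw : Measure.map X P = gaussianReal 0 v)
    (hind : Indep m (MeasurableSpace.comap X inferInstance) P) (u : ℝ) :
    ∫ ω, Complex.exp (u * (S ω + ε ω * X ω : ℝ) * Complex.I) ∂P =
      (∫ ω, Complex.exp (u * (S ω : ℝ) * Complex.I) ∂P) * Complex.exp (-(v * u ^ 2 / 2)) := by
  have hS' : Measurable S := hS.mono hm le_rfl
  have hε' : Measurable ε := hε.mono hm le_rfl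
  have hchar : ∀ w : ℝ, ∫ ω, Complex.exp (w * (X ω : ℝ) * Complex.I) ∂P
      = Complex.exp (-(v * w ^ 2 / 2)) := by
    intro w
    have := charFun_gaussianReal (μ := 0) (v := v) w
    rw [← hlaw, charFun_apply_real, integral_map hX.aemeasurable (by fun_prop)] at this
    rw [this]; congr 1; push_cast; ring
  have hindep : ∀ (c w : ℝ), ∫ ω, (Complex.exp (u * (S ω : ℝ) * Complex.I) *
      (((1 + c * ε ω) / 2 : ℝ) : ℂ)) * Complex.exp (w * (X ω : ℝ) * Complex.I) ∂P =
      (∫ ω, (Complex.exp (u * (S ω : ℝ) * Complex.I) * (((1 + c * ε ω) / 2 : ℝ) : ℂ)) ∂P) *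
      ∫ ω, Complex.exp (w * (X ω : ℝ) * Complex.I) ∂P := by
    intro c w
    have hp : Measurable[m] (fun ω => (S ω, ε ω)) := hS.prodMk hε
    have hi : IndepFun (fun ω => (S ω, ε ω)) X P := by
      rw [IndepFun_iff_Indep]
      exact indep_of_indep_of_le_left hind hp.comap_le
    have hi2 := hi.comp
      (φ := fun p : ℝ × ℝ => Complex.exp (u * (p.1 : ℝ) * Complex.I) *
        (((1 + c * p.2) / 2 : ℝ) : ℂ))
      (ψ := fun y : ℝ => Complex.exp (w * (y : ℝ) * Complex.I)) (by fun_prop) (by fun_prop)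
    exact hi2.integral_fun_mul_eq_mul_integral (by fun_prop) (by fun_prop)
  have hnorm : ∀ (w y : ℝ), ‖Complex.exp (w * (y : ℝ) * Complex.I)‖ = 1 := by
    intro w y
    rw [← Complex.ofReal_mul, Complex.norm_exp_ofReal_mul_I]
  have hbd : ∀ (c : ℝ) (hc : |c| ≤ 1) ω, ‖(((1 + c * ε ω) / 2 : ℝ) : ℂ)‖ ≤ 1 := by
    intro c hc ω
    rw [Complex.norm_real, Real.norm_eq_abs, abs_le]
    have := abs_le.1 hc
    rcases hε1 ω with h | h <;> rw [h] <;> constructor <;> linarith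
  have integ1 : ∀ (c : ℝ) (hc : |c| ≤ 1), Integrable (fun ω =>
      (Complex.exp (u * (S ω : ℝ) * Complex.I) * (((1 + c * ε ω) / 2 : ℝ) : ℂ))) P := by
    intro c hc
    refine Integrable.of_bound (by fun_prop) 1 (ae_of_all _ fun ω => ?_)
    rw [norm_mul, hnorm, one_mul]; exact hbd c hc ω
  have integ2 : ∀ (c w : ℝ) (hc : |c| ≤ 1), Integrable (fun ω =>
      (Complex.exp (u * (S ω : ℝ) * Complex.I) * (((1 + c * ε ω) / 2 : ℝ) : ℂ)) *
      Complex.exp (w * (X ω : ℝ) * Complex.I)) P := by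
    intro c w hc
    refine Integrable.of_bound (by fun_prop) 1 (ae_of_all _ fun ω => ?_)
    rw [norm_mul, norm_mul, hnorm, hnorm, one_mul, mul_one]; exact hbd c hc ω
  have e1 : ∀ ω, Complex.exp (u * (S ω + ε ω * X ω : ℝ) * Complex.I) =
      (Complex.exp (u * (S ω : ℝ) * Complex.I) * (((1 + 1 * ε ω) / 2 : ℝ) : ℂ)) *
        Complex.exp ((u : ℝ) * (X ω : ℝ) * Complex.I) +
      (Complex.exp (u * (S ω : ℝ) * Complex.I) * (((1 + (-1) * ε ω) / 2 : ℝ) : ℂ)) *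
        Complex.exp ((-u : ℝ) * (X ω : ℝ) * Complex.I) := by
    intro ω
    rcases hε1 ω with h | h <;> rw [h]
    · norm_num
      rw [← Complex.exp_add]; congr 1; ring
    · norm_num
      rw [← Complex.exp_add]; congr 1; ring
  have e2 : ∀ ω, Complex.exp (u * (S ω : ℝ) * Complex.I) =
      (Complex.exp (u * (S ω : ℝ) * Complex.I) * (((1 + 1 * ε ω) / 2 : ℝ) : ℂ)) +
      (Complex.exp (u * (S ω : ℝ) * Complex.I) * (((1 + (-1) * ε ω) / 2 : ℝ) : ℂ)) := by
    intro ω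
    push_cast; ring
  have e3 : ∫ ω, Complex.exp (u * (S ω : ℝ) * Complex.I) ∂P =
      (∫ ω, (Complex.exp (u * (S ω : ℝ) * Complex.I) * (((1 + 1 * ε ω) / 2 : ℝ) : ℂ)) ∂P) +
      ∫ ω, (Complex.exp (u * (S ω : ℝ) * Complex.I) * (((1 + (-1) * ε ω) / 2 : ℝ) : ℂ)) ∂P := by
    rw [← integral_add (integ1 1 (by simp)) (integ1 (-1) (by simp))]
    exact integral_congr_ae (ae_of_all _ e2)
  rw [integral_congr_ae (ae_of_all _ e1), integral_add (integ2 1 u (by simp))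
    (integ2 (-1) (-u) (by simp)), hindep, hindep, hchar, hchar, e3, add_mul]
  congr 3
  push_cast
  ring

/-- The past sigma-algebra. -/
def past {Ω : Type*} (B : ℝ → Ω → ℝ) (s : ℝ) : MeasurableSpace Ω :=
  ⨆ r ∈ Set.Icc (0 : ℝ) s, MeasurableSpace.comap (B r) inferInstance

lemma past_mono {Ω : Type*} (B : ℝ → Ω → ℝ) {s t : ℝ} (h : s ≤ t) : past B s ≤ past B t :=
  biSup_mono fun _ hr => ⟨hr.1, hr.2.trans h⟩

lemma past_meas {Ω : Type*} (B : ℝ → Ω → ℝ) {r s : ℝ} (h0 : 0 ≤ r) (h : r ≤ s) :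
    Measurable[past B s] (B r) :=
  measurable_iff_comap_le.2 (le_iSup₂_of_le (f := fun r (_ : r ∈ Set.Icc (0 : ℝ) s) =>
    MeasurableSpace.comap (B r) inferInstance) r ⟨h0, h⟩ le_rfl)

lemma past_le {Ω : Type*} [m0 : MeasurableSpace Ω] {B : ℝ → Ω → ℝ} (h : ∀ t, Measurable (B t))
    (s : ℝ) : past B s ≤ m0 :=
  iSup₂_le fun r _ => (h r).comap_le

/-- Brownian motion with all paths continuous and starting at `0`. -/
structure NiceBM {Ω : Type*} [MeasurableSpace Ω] (P : Measure Ω) (X : ℝ → Ω → ℝ) : Prop where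
  bm : IsStdBrownianMotion P X
  cont : ∀ ω, Continuous fun t => X t ω
  init : ∀ ω, X 0 ω = 0

lemma NiceBM.alt_meas {Ω : Type*} [MeasurableSpace Ω] {P : Measure Ω} {X : ℝ → Ω → ℝ}
    (hX : NiceBM P X) {a : ℝ} (ha : 0 < a) (k : ℕ) {s : ℝ} (hs : 0 ≤ s) :
    MeasurableSet[past X s] {ω | Alt (fun t => X t ω) a k s} := by
  induction k generalizing s with
  | zero => simp [Alt, hs]
  | succ k ih =>
    have : {ω | Alt (fun t => X t ω) a (k + 1) s} = ⋂ n : ℕ, ⋃ q : ℚ,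
        ({ω | Alt (fun t => X t ω) a k (max 0 (min (q : ℝ) s))} ∩
        {ω | |X (max 0 (min (q : ℝ) s)) ω - tgt a (k + 1)| < 1 / ((n : ℝ) + 1)}) := by
      ext ω
      simp only [Set.mem_iInter, Set.mem_iUnion]
      exact alt_succ_iff ha (hX.cont ω) (hX.init ω) k hs
    rw [this]
    refine MeasurableSet.iInter fun n => MeasurableSet.iUnion fun q => MeasurableSet.inter ?_ ?_
    · exact past_mono X (max_le hs (min_le_right _ _)) _ (ih (le_max_left _ _))
    · have h1 : Measurable[past X s] (X (max 0 (min (q : ℝ) s))) :=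
        past_meas X (le_max_left _ _) (max_le hs (min_le_right _ _))
      have h2 : MeasurableSet {y : ℝ | |y - tgt a (k + 1)| < 1 / ((n : ℝ) + 1)} :=
        measurableSet_lt (by fun_prop) (by fun_prop)
      exact h1 h2

lemma NiceBM.altInd_meas {Ω : Type*} [MeasurableSpace Ω] {P : Measure Ω} {X : ℝ → Ω → ℝ}
    (hX : NiceBM P X) {a : ℝ} (ha : 0 < a) (k : ℕ) {s : ℝ} (hs : 0 ≤ s) :
    Measurable[past X s] (fun ω => altInd (fun t => X t ω) a k s) := by
  classical
  unfold altInd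
  exact Measurable.ite (hX.alt_meas ha k hs) measurable_const measurable_const

lemma NiceBM.sgn_meas {Ω : Type*} [MeasurableSpace Ω] {P : Measure Ω} {X : ℝ → Ω → ℝ}
    (hX : NiceBM P X) {a : ℝ} (ha : 0 < a) (K : ℕ) {s : ℝ} (hs : 0 ≤ s) :
    Measurable[past X s] (fun ω => sgn (fun t => X t ω) a K s) := by
  unfold sgn
  refine measurable_const.add (Finset.measurable_fun_sum _ fun k _ => ?_)
  exact (hX.altInd_meas ha (k + 1) hs).const_mul _

lemma NiceBM.reflPath_meas {Ω : Type*} [MeasurableSpace Ω] {P : Measure Ω} {X : ℝ → Ω → ℝ}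
    (hX : NiceBM P X) {a : ℝ} (ha : 0 < a) (K : ℕ) {s : ℝ} (hs : 0 ≤ s) :
    Measurable (fun ω => reflPath (fun t => X t ω) a K s) := by
  unfold reflPath
  refine (hX.bm.meas s).add (Finset.measurable_fun_sum _ fun k _ => ?_)
  exact (((hX.altInd_meas ha (k + 1) hs).mono (past_le hX.bm.meas s) le_rfl).mul
    ((hX.bm.meas s).sub measurable_const)).const_mul _

lemma NiceBM.charSum {Ω : Type*} [MeasurableSpace Ω] {P : Measure Ω} {X : ℝ → Ω → ℝ}
    (hX : NiceBM P X) {a : ℝ} (ha : 0 < a) (K : ℕ) {t : ℝ} (ht : 0 < t) {n : ℕ} (hn : 1 ≤ n)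
    (u : ℝ) (m : ℕ) :
    ∫ ω, Complex.exp (u * ((∑ j ∈ Finset.range m, sgn (fun t => X t ω) a K (t * ((j : ℝ) / n)) *
      (X (t * (((j + 1 : ℕ) : ℝ) / n)) ω - X (t * ((j : ℝ) / n)) ω) : ℝ) : ℂ) * Complex.I) ∂P =
      Complex.exp (-(((m : ℝ) * (t / n) : ℝ) * u ^ 2 / 2)) := by
  have := hX.bm.isProb
  have hn0 : (0 : ℝ) < n := by exact_mod_cast hn
  have hg0 : ∀ j : ℕ, 0 ≤ t * ((j : ℝ) / n) := fun j => by positivity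
  have hg : ∀ {i j : ℕ}, i ≤ j → t * ((i : ℝ) / n) ≤ t * ((j : ℝ) / n) := by
    intro i j hij
    have : (i : ℝ) ≤ j := by exact_mod_cast hij
    gcongr
  induction m with
  | zero => simp
  | succ m ih =>
    have hS : Measurable[past X (t * ((m : ℝ) / n))] (fun ω =>
        ∑ j ∈ Finset.range m, sgn (fun t => X t ω) a K (t * ((j : ℝ) / n)) *
        (X (t * (((j + 1 : ℕ) : ℝ) / n)) ω - X (t * ((j : ℝ) / n)) ω)) := by
      refine Finset.measurable_fun_sum _ fun j hj => ?_
      have hj' := Finset.mem_range.1 hj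
      refine Measurable.mul ?_ (Measurable.sub ?_ ?_)
      · exact (hX.sgn_meas ha K (hg0 j)).mono (past_mono X (hg hj'.le)) le_rfl
      · exact past_meas X (hg0 (j + 1)) (hg hj')
      · exact past_meas X (hg0 j) (hg hj'.le)
    have hst := charStep (P := P) (past_le hX.bm.meas _) hS (hX.sgn_meas ha K (hg0 m))
      (fun ω => (sgn_aux _ a K _).2)
      ((hX.bm.meas (t * (((m + 1 : ℕ) : ℝ) / n))).sub (hX.bm.meas (t * ((m : ℝ) / n))))
      (hX.bm.incr _ _ (hg0 m) (hg m.le_succ)) (hX.bm.indep _ _ (hg0 m) (hg m.le_succ)) u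
    simp only [Finset.sum_range_succ]
    refine hst.trans ?_
    rw [ih, ← Complex.exp_add]
    congr 1
    have hv : ((Real.toNNReal (t * (((m + 1 : ℕ) : ℝ) / n) - t * ((m : ℝ) / n)) : ℝ≥0) : ℝ)
        = t / n := by
      rw [Real.coe_toNNReal _ (sub_nonneg.2 (hg m.le_succ))]
      push_cast; field_simp; ring
    have hv' : (((Real.toNNReal (t * (((m + 1 : ℕ) : ℝ) / n) - t * ((m : ℝ) / n)) : ℝ≥0) : ℝ) : ℂ)
        = ((t / n : ℝ) : ℂ) := by rw [hv]
    erw [hv']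
    push_cast
    ring

lemma NiceBM.reflPath_law {Ω : Type*} [MeasurableSpace Ω] {P : Measure Ω} {X : ℝ → Ω → ℝ}
    (hX : NiceBM P X) {a : ℝ} (ha : 0 < a) (K : ℕ) {t : ℝ} (ht : 0 < t) :
    Measure.map (fun ω => reflPath (fun t => X t ω) a K t) P = gaussianReal 0 (Real.toNNReal t) := by
  have := hX.bm.isProb
  have hm := hX.reflPath_meas ha K ht.le
  have := Measure.isProbabilityMeasure_map (μ := P) hm.aemeasurable
  refine Measure.ext_of_charFun ?_
  ext u
  rw [charFun_gaussianReal, charFun_apply_real, integral_map hm.aemeasurable (by fun_prop)]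
  have hlim : Tendsto (fun n : ℕ => ∫ ω, Complex.exp (u * ((∑ j ∈ Finset.range n,
      sgn (fun t => X t ω) a K (t * ((j : ℝ) / n)) *
      (X (t * (((j + 1 : ℕ) : ℝ) / n)) ω - X (t * ((j : ℝ) / n)) ω) : ℝ) : ℂ) * Complex.I) ∂P)
      atTop (nhds (∫ ω, Complex.exp (u * (reflPath (fun t => X t ω) a K t : ℝ) * Complex.I) ∂P)) := by
    refine tendsto_integral_of_dominated_convergence (fun _ => 1) ?_ (integrable_const _) ?_ ?_
    · intro n
      have : Measurable fun ω => ∑ j ∈ Finset.range n,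
          sgn (fun t => X t ω) a K (t * ((j : ℝ) / n)) *
          (X (t * (((j + 1 : ℕ) : ℝ) / n)) ω - X (t * ((j : ℝ) / n)) ω) := by
        refine Finset.measurable_fun_sum _ fun j hj => Measurable.mul ?_ (Measurable.sub ?_ ?_)
        · exact (hX.sgn_meas ha K (by positivity)).mono (past_le hX.bm.meas _) le_rfl
        · exact hX.bm.meas _
        · exact hX.bm.meas _
      exact (by fun_prop : Measurable fun ω => Complex.exp (u * ((∑ j ∈ Finset.range n,
          sgn (fun t => X t ω) a K (t * ((j : ℝ) / n)) *
          (X (t * (((j + 1 : ℕ) : ℝ) / n)) ω - X (t * ((j : ℝ) / n)) ω) : ℝ) : ℂ)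
          * Complex.I)).aestronglyMeasurable
    · intro n
      refine ae_of_all _ fun ω => ?_
      rw [← Complex.ofReal_mul, Complex.norm_exp_ofReal_mul_I]
    · refine ae_of_all _ fun ω => ?_
      have h1 := sgn_sum_tendsto (a := a) (hX.cont ω) (hX.init ω) K ht
      have hc : Continuous fun y : ℝ => Complex.exp (u * (y : ℂ) * Complex.I) := by fun_prop
      exact (hc.tendsto _).comp h1
  refine tendsto_nhds_unique hlim ?_
  refine tendsto_const_nhds.congr' ?_
  filter_upwards [eventually_ge_atTop 1] with n hn
  have hn0 : (n : ℝ) ≠ 0 := by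
    have : 0 < n := hn
    positivity
  rw [hX.charSum ha K ht hn u n, mul_div_cancel₀ _ hn0]
  congr 1
  have : ((Real.toNNReal t : ℝ≥0) : ℝ) = t := Real.coe_toNNReal _ ht.le
  have h2 : (((Real.toNNReal t : ℝ≥0) : ℝ) : ℂ) = t := by rw [this]
  erw [h2]
  simp

lemma past_eq_comap {Ω : Type*} (B : ℝ → Ω → ℝ) (s : ℝ) :
    past B s = MeasurableSpace.comap (fun ω (r : Set.Icc (0 : ℝ) s) => B r ω) inferInstance := by
  unfold past
  rw [iSup_subtype']
  simp only [MeasurableSpace.pi, MeasurableSpace.comap_iSup, MeasurableSpace.comap_comp]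
  rfl

lemma exists_nice {Ω : Type*} [MeasurableSpace Ω] {P : Measure Ω} {B : ℝ → Ω → ℝ}
    (hB : IsStdBrownianMotion P B) :
    ∃ X : ℝ → Ω → ℝ, NiceBM P X ∧ ∀ᵐ ω ∂P, ∀ t, 0 ≤ t → B t ω = X t ω := by
  classical
  have hE : ∀ᵐ ω ∂P, B 0 ω = 0 ∧ ContinuousOn (fun t => B t ω) (Set.Ici 0) :=
    hB.init.and hB.cont
  set N := toMeasurable P {ω | ¬ (B 0 ω = 0 ∧ ContinuousOn (fun t => B t ω) (Set.Ici 0))} with hN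
  have hNm : MeasurableSet N := measurableSet_toMeasurable _ _
  have hN0 : P N = 0 := by rw [hN, measure_toMeasurable]; exact hE
  have hNae : ∀ᵐ ω ∂P, ω ∉ N := measure_eq_zero_iff_ae_notMem.1 hN0
  have hgood : ∀ ω, ω ∉ N → B 0 ω = 0 ∧ ContinuousOn (fun t => B t ω) (Set.Ici 0) := by
    intro ω hω
    by_contra h
    exact hω (subset_toMeasurable _ _ h)
  refine ⟨fun t ω => if ω ∈ N then 0 else B (max 0 t) ω, ?_, ?_⟩
  swap
  · filter_upwards [hNae] with ω hω t ht
    rw [if_neg hω, max_eq_right ht]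
  have hXB : ∀ᵐ ω ∂P, ∀ t, 0 ≤ t → B t ω = if ω ∈ N then 0 else B (max 0 t) ω := by
    filter_upwards [hNae] with ω hω t ht
    rw [if_neg hω, max_eq_right ht]
  have hcont : ∀ ω, Continuous fun t => if ω ∈ N then 0 else B (max 0 t) ω := by
    intro ω
    by_cases hω : ω ∈ N
    · simp only [if_pos hω]; exact continuous_const
    · simp only [if_neg hω]
      exact (hgood ω hω).2.comp_continuous (f := fun t : ℝ => max 0 t) (by fun_prop)
        (fun t => Set.mem_Ici.2 (le_max_left _ _))
  have hinit : ∀ ω, (if ω ∈ N then 0 else B (max 0 0) ω) = 0 := by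
    intro ω
    by_cases hω : ω ∈ N
    · simp only [if_pos hω]
    · rw [if_neg hω, max_self]; exact (hgood ω hω).1
  refine ⟨⟨hB.isProb, ?_, ae_of_all _ hinit, ae_of_all _ fun ω => (hcont ω).continuousOn, ?_, ?_⟩,
    hcont, hinit⟩
  · intro t
    exact Measurable.ite hNm measurable_const (hB.meas _)
  · intro s t hs hst
    rw [← hB.incr s t hs hst]
    refine Measure.map_congr ?_
    filter_upwards [hXB] with ω hω
    rw [← hω s hs, ← hω t (hs.trans hst)]
  · intro s t hs hst
    have h1 := hB.indep s t hs hst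
    change Indep (past _ s) _ P
    change Indep (past _ s) _ P at h1
    rw [past_eq_comap, ← IndepFun_iff_Indep] at h1 ⊢
    refine h1.congr ?_ ?_
    · filter_upwards [hXB] with ω hω
      funext r
      exact hω r r.2.1
    · filter_upwards [hXB] with ω hω
      rw [← hω s hs, ← hω t (hs.trans hst)]

/-- the common distribution function -/
noncomputable def hitCdf (c t : ℝ) : ENNReal :=
  gaussianReal 0 (Real.toNNReal t) (Set.Ici c) + gaussianReal 0 (Real.toNNReal t) (Set.Ioi c)

lemma NiceBM.alt_prob {Ω : Type*} [MeasurableSpace Ω] {P : Measure Ω} {X : ℝ → Ω → ℝ}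
    (hX : NiceBM P X) {a : ℝ} (ha : 0 < a) (K : ℕ) {t : ℝ} (ht : 0 < t) :
    P {ω | Alt (fun t => X t ω) a (K + 1) t} = hitCdf (a * (K + 1)) t := by
  have hm1 := hX.reflPath_meas ha K ht.le
  have hm2 := hX.reflPath_meas ha (K + 1) ht.le
  have hset : {ω | Alt (fun t => X t ω) a (K + 1) t} =
      ((fun ω => reflPath (fun t => X t ω) a K t) ⁻¹' Set.Ici (a * (K + 1))) ∪
      ((fun ω => reflPath (fun t => X t ω) a (K + 1) t) ⁻¹' Set.Ioi (a * (K + 1))) := by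
    ext ω
    simp only [Set.mem_ofPred_eq, Set.mem_union, Set.mem_preimage, Set.mem_Ici, Set.mem_Ioi]
    by_cases h : Alt (fun t => X t ω) a (K + 1) t
    · have := reflPath_succ_of_alt _ a K t h
      simp only [h, true_iff]
      rcases le_or_gt (a * (K + 1)) (reflPath (fun t => X t ω) a K t) with h' | h'
      · exact Or.inl h'
      · right; linarith
    · have h1 := reflPath_lt ha (hX.cont ω) (hX.init ω) K t ht.le h
      have h2 := reflPath_succ_of_not_alt _ a K t h
      simp only [h, false_iff, not_or, not_le, not_lt]
      exact ⟨h1, by rw [h2]; exact h1.le⟩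
  have hdisj : Disjoint
      ((fun ω => reflPath (fun t => X t ω) a K t) ⁻¹' Set.Ici (a * (K + 1)))
      ((fun ω => reflPath (fun t => X t ω) a (K + 1) t) ⁻¹' Set.Ioi (a * (K + 1))) := by
    rw [Set.disjoint_left]
    intro ω h1 h2
    simp only [Set.mem_preimage, Set.mem_Ici, Set.mem_Ioi] at h1 h2
    by_cases h : Alt (fun t => X t ω) a (K + 1) t
    · have := reflPath_succ_of_alt _ a K t h
      linarith
    · have := reflPath_lt ha (hX.cont ω) (hX.init ω) K t ht.le h
      linarith
  rw [hset, measure_union hdisj (hm2 measurableSet_Ioi), hitCdf,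
    ← Measure.map_apply hm1 measurableSet_Ici, ← Measure.map_apply hm2 measurableSet_Ioi,
    hX.reflPath_law ha K ht, hX.reflPath_law ha (K + 1) ht]

lemma hitCdf_add {c t : ℝ} (hc : 0 < c) :
    hitCdf c t + gaussianReal 0 (Real.toNNReal t) (Set.Ico (-c) c) = 1 := by
  set γ := gaussianReal 0 (Real.toNNReal t)
  have hsym : γ (Set.Ioi c) = γ (Set.Iio (-c)) := by
    have h := gaussianReal_map_neg (μ := 0) (v := Real.toNNReal t)
    rw [neg_zero] at h
    have h2 : γ (Set.Ioi c) = (γ.map (fun x => -x)) (Set.Ioi c) := by rw [h]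
    rw [h2, Measure.map_apply measurable_neg measurableSet_Ioi]
    congr 1
    ext y; simp
  have h1 : γ (Set.Iio (-c)) + γ (Set.Ico (-c) c) = γ (Set.Iio c) := by
    rw [← measure_union _ measurableSet_Ico, Set.Iio_union_Ico_eq_Iio (by linarith)]
    rw [Set.disjoint_left]
    intro y h1 h2
    exact absurd h2.1 (not_le.2 h1)
  have h2 : γ (Set.Ici c) + γ (Set.Iio c) = 1 := by
    rw [← measure_union _ measurableSet_Iio, Set.Ici_union_Iio, measure_univ]
    rw [Set.disjoint_left]
    intro y h1 h2
    exact absurd (Set.mem_Ici.1 h1) (not_le.2 (Set.mem_Iio.1 h2))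
  change γ (Set.Ici c) + γ (Set.Ioi c) + γ (Set.Ico (-c) c) = 1
  rw [hsym, add_assoc, h1, h2]

open Topology in
lemma gauss_Ico_tendsto (c : ℝ) :
    Tendsto (fun n : ℕ => gaussianReal 0 (Real.toNNReal (n : ℝ)) (Set.Ico (-c) c)) atTop (𝓝 0) := by
  have hb : ∀ n : ℕ, 1 ≤ n → gaussianReal 0 (Real.toNNReal (n : ℝ)) (Set.Ico (-c) c) ≤
      ENNReal.ofReal ((√(2 * Real.pi * n))⁻¹) * volume (Set.Ico (-c) c) := by
    intro n hn
    have hn0 : (0 : ℝ) < n := by exact_mod_cast hn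
    have hv : Real.toNNReal (n : ℝ) ≠ 0 := by simpa using (by omega : n ≠ 0)
    rw [gaussianReal_apply _ hv]
    refine (lintegral_mono (g := fun _ => ENNReal.ofReal ((√(2 * Real.pi * n))⁻¹)) ?_).trans ?_
    · intro y
      unfold gaussianPDF gaussianPDFReal
      refine ENNReal.ofReal_le_ofReal ?_
      rw [Real.coe_toNNReal _ hn0.le]
      refine mul_le_of_le_one_right (by positivity) ?_
      rw [Real.exp_le_one_iff]
      have : 0 ≤ (y - 0) ^ 2 / (2 * (n : ℝ)) := by positivity
      rw [neg_div]; linarith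
    · rw [setLIntegral_const]
  have hz : Tendsto (fun n : ℕ => ENNReal.ofReal ((√(2 * Real.pi * n))⁻¹) *
      volume (Set.Ico (-c) c)) atTop (𝓝 0) := by
    have h1 : Tendsto (fun n : ℕ => (√(2 * Real.pi * n))⁻¹) atTop (𝓝 0) := by
      refine tendsto_inv_atTop_zero.comp (Real.tendsto_sqrt_atTop.comp ?_)
      exact tendsto_natCast_atTop_atTop.const_mul_atTop (by positivity)
    have h2 := ENNReal.tendsto_ofReal h1
    rw [ENNReal.ofReal_zero] at h2
    have h3 := ENNReal.Tendsto.mul_const (b := volume (Set.Ico (-c) c)) h2 (Or.inr (by simp))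
    rwa [zero_mul] at h3
  refine tendsto_of_tendsto_of_tendsto_of_le_of_le' tendsto_const_nhds hz
    (Eventually.of_forall fun _ => zero_le) ?_
  filter_upwards [eventually_ge_atTop 1] with n hn using hb n hn

lemma NiceBM.ae_alt {Ω : Type*} [MeasurableSpace Ω] {P : Measure Ω} {X : ℝ → Ω → ℝ}
    (hX : NiceBM P X) {a : ℝ} (ha : 0 < a) : ∀ᵐ ω ∂P, ∀ K, ∃ t, Alt (fun t => X t ω) a K t := by
  have := hX.bm.isProb
  rw [ae_all_iff]
  intro K
  cases K with
  | zero => exact ae_of_all _ fun ω => ⟨0, le_refl (0 : ℝ)⟩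
  | succ K =>
    have hc : 0 < a * ((K : ℝ) + 1) := by positivity
    rw [ae_iff]
    refine le_antisymm ?_ (zero_le)
    refine ge_of_tendsto (gauss_Ico_tendsto (a * ((K : ℝ) + 1))) ?_
    filter_upwards [eventually_ge_atTop 1] with n hn
    have hn0 : (0 : ℝ) < n := by exact_mod_cast hn
    have hms : MeasurableSet {ω | Alt (fun t => X t ω) a (K + 1) n} :=
      past_le hX.bm.meas _ _ (hX.alt_meas ha (K + 1) hn0.le)
    have h1 : P {ω | Alt (fun t => X t ω) a (K + 1) n}ᶜ =
        gaussianReal 0 (Real.toNNReal (n : ℝ)) (Set.Ico (-(a * ((K : ℝ) + 1))) (a * (K + 1))) := by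
      have h2 := prob_add_prob_compl (μ := P) hms
      rw [hX.alt_prob ha K hn0, ← hitCdf_add (t := n) hc] at h2
      refine (ENNReal.add_right_inj ?_).1 h2
      exact ENNReal.add_ne_top.2 ⟨measure_ne_top _ _, measure_ne_top _ _⟩
    rw [← h1]
    refine measure_mono fun ω hω h => hω ⟨n, h⟩

lemma not_alt_of_nonpos {x : ℝ → ℝ} {a : ℝ} (ha : 0 < a) (h0 : x 0 = 0) (K : ℕ) {t : ℝ}
    (ht : t ≤ 0) : ¬ Alt x a (K + 1) t := by
  induction K with
  | zero =>
    rintro ⟨r, h1, h2, h3⟩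
    have : r = 0 := le_antisymm (h2.trans ht) h1
    rw [this, h0, tgt, if_pos (by simp)] at h3
    exact ha.ne h3
  | succ K ih => exact fun h => ih h.pred

lemma NiceBM.law_hit {Ω : Type*} [MeasurableSpace Ω] {P : Measure Ω} {X : ℝ → Ω → ℝ}
    (hX : NiceBM P X) {a : ℝ} (ha : 0 < a) (K : ℕ) {T : Ω → ℝ}
    (hT : ∀ᵐ ω ∂P, ∀ t, Alt (fun t => X t ω) a (K + 1) t ↔ T ω ≤ t) :
    AEMeasurable T P ∧ ∀ t, Measure.map T P (Set.Iic t) =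
      if 0 < t then hitCdf (a * (K + 1)) t else 0 := by
  have hset : ∀ t, (T ⁻¹' Set.Iic t : Set Ω) =ᵐ[P] {ω | Alt (fun t => X t ω) a (K + 1) t} := by
    intro t
    filter_upwards [hT] with ω hω
    exact propext (hω t).symm
  have hemp : ∀ t, t ≤ 0 → {ω | Alt (fun t => X t ω) a (K + 1) t} = ∅ := by
    intro t ht
    ext ω
    simpa using not_alt_of_nonpos ha (hX.init ω) K ht
  have hmeas : ∀ t, MeasurableSet {ω | Alt (fun t => X t ω) a (K + 1) t} := by
    intro t
    rcases le_or_gt t 0 with ht | ht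
    · rw [hemp t ht]; exact MeasurableSet.empty
    · exact past_le hX.bm.meas _ _ (hX.alt_meas ha (K + 1) ht.le)
  have hnull : NullMeasurable T P := by
    refine measurable_of_Iic (α := ℝ) (δ := NullMeasurableSpace Ω P) fun t => ?_
    exact (hmeas t).nullMeasurableSet.congr (hset t).symm
  refine ⟨hnull.aemeasurable, fun t => ?_⟩
  rw [Measure.map_apply_of_aemeasurable hnull.aemeasurable measurableSet_Iic, measure_congr (hset t)]
  split_ifs with ht
  · exact hX.alt_prob ha K ht
  · rw [hemp t (not_lt.1 ht), measure_empty]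

lemma sInf_next {x y : ℝ → ℝ} {a : ℝ} (ha : 0 < a) (hxy : ∀ t, 0 ≤ t → y t = x t) {F : ℕ → ℝ}
    (hF : ∀ k, x (F k) = tgt a k ∧ ∀ s, Alt x a k s ↔ F k ≤ s) (k : ℕ) :
    sInf {t : ℝ | F k < t ∧ y t = tgt a (k + 1)} = F (k + 1) := by
  have h0 : ∀ k, 0 ≤ F k := fun k => (((hF k).2 _).2 le_rfl).nonneg
  refine IsLeast.csInf_eq ⟨⟨?_, ?_⟩, ?_⟩
  · have h1 : F k ≤ F (k + 1) := ((hF k).2 _).1 (((hF (k + 1)).2 _).2 le_rfl).pred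
    refine lt_of_le_of_ne h1 fun h => tgt_ne ha k ?_
    rw [← (hF k).1, ← (hF (k + 1)).1, h]
  · rw [hxy _ (h0 _)]; exact (hF _).1
  · rintro t ⟨h1, h2⟩
    rw [hxy t ((h0 k).trans h1.le)] at h2
    exact ((hF (k + 1)).2 t).1 ⟨t, ((hF k).2 t).2 h1.le, le_rfl, h2⟩

lemma sigTau_eq {Ω : Type*} {B : ℝ → Ω → ℝ} {ω : Ω} {x : ℝ → ℝ} (hxy : ∀ t, 0 ≤ t → B t ω = x t)
    {F : ℕ → ℝ} (hF : ∀ k, x (F k) = tgt 2 k ∧ ∀ s, Alt x 2 k s ↔ F k ≤ s) (n : ℕ) :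
    (sigTau B ω n).2 = F (2 * n + 1) := by
  have hodd : ∀ k, tgt 2 (2 * k + 1) = 2 := fun k => by
    rw [tgt, if_pos (odd_two_mul_add_one k)]
  have heven : ∀ k, tgt 2 (2 * k + 1 + 1) = 0 := fun k => by
    rw [tgt, if_neg (by simpa using (odd_two_mul_add_one k).add_one)]
  have hF0 : F 0 = 0 := le_antisymm (((hF 0).2 0).1 (le_refl (0 : ℝ)))
    (((hF 0).2 _).2 le_rfl).nonneg
  have hnext := fun k => sInf_next (y := fun t => B t ω) two_pos hxy hF k
  induction n with
  | zero =>
    have := hnext 0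
    rw [hF0, hodd 0] at this
    exact this
  | succ n ih =>
    have h1 := hnext (2 * n + 1)
    have h2 := hnext (2 * n + 1 + 1)
    rw [heven] at h1
    have h3 : tgt 2 (2 * n + 1 + 1 + 1) = 2 := hodd (n + 1)
    rw [h3] at h2
    simp only [sigTau, ih]
    rw [h1]
    exact h2

/-- For every `i₀ ≥ 1`, the time `τ_{i₀}` of the `i₀`-th excursion from `0` to `2`
has the same distribution as the hitting time of the level `2(2 i₀ − 1)`. -/
theorem excursion_time_eq_hitting_time {Ω : Type*} [MeasurableSpace Ω] (P : Measure Ω)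
    (B : ℝ → Ω → ℝ) (hB : IsStdBrownianMotion P B) (i₀ : ℕ) (hi₀ : 1 ≤ i₀) :
    Measure.map (fun ω => (sigTau B ω (i₀ - 1)).2) P =
      Measure.map (fun ω => sInf {t : ℝ | 0 < t ∧ B t ω = 2 * (2 * (i₀ : ℝ) - 1)}) P := by
  obtain ⟨X, hX, hBX⟩ := exists_nice hB
  have := hX.bm.isProb
  obtain ⟨n, rfl⟩ : ∃ n, i₀ = n + 1 := ⟨i₀ - 1, by omega⟩
  set c : ℝ := 2 * (2 * ((n + 1 : ℕ) : ℝ) - 1) with hc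
  have hcpos : 0 < c := by
    rw [hc]; push_cast
    have : (0 : ℝ) ≤ n := Nat.cast_nonneg n
    linarith
  have hT1 : ∀ᵐ ω ∂P, ∀ t, Alt (fun t => X t ω) 2 (2 * n + 1) t ↔
      (sigTau B ω (n + 1 - 1)).2 ≤ t := by
    filter_upwards [hBX, hX.ae_alt two_pos] with ω h1 h2 t
    have h3 : ∀ k, ∃ T, X T ω = tgt 2 k ∧ ∀ s, Alt (fun t => X t ω) 2 k s ↔ T ≤ s := fun k =>
      (h2 k).elim fun s hs => hs.exists_first (hX.cont ω) (hX.init ω)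
    choose F hF using h3
    rw [Nat.add_sub_cancel, sigTau_eq h1 hF]
    exact (hF _).2 t
  have hT2 : ∀ᵐ ω ∂P, ∀ t, Alt (fun t => X t ω) c (0 + 1) t ↔
      sInf {t : ℝ | 0 < t ∧ B t ω = c} ≤ t := by
    filter_upwards [hBX, hX.ae_alt hcpos] with ω h1 h2 t
    have h3 : ∀ k, ∃ T, X T ω = tgt c k ∧ ∀ s, Alt (fun t => X t ω) c k s ↔ T ≤ s := fun k =>
      (h2 k).elim fun s hs => hs.exists_first (hX.cont ω) (hX.init ω)
    choose F hF using h3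
    have hF0 : F 0 = 0 := le_antisymm (((hF 0).2 0).1 (le_refl (0 : ℝ)))
      (((hF 0).2 _).2 le_rfl).nonneg
    have hn := sInf_next (y := fun t => B t ω) hcpos h1 hF 0
    have hodd : tgt c (0 + 1) = c := by rw [tgt, if_pos (by simp)]
    rw [hF0, hodd] at hn
    rw [hn]
    exact (hF _).2 t
  obtain ⟨m1, l1⟩ := hX.law_hit two_pos (2 * n) hT1
  obtain ⟨m2, l2⟩ := hX.law_hit hcpos 0 hT2
  have := Measure.isProbabilityMeasure_map m1
  have := Measure.isProbabilityMeasure_map m2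
  refine Measure.ext_of_Iic _ _ fun t => ?_
  rw [l1 t, l2 t]
  have : (2 : ℝ) * (((2 * n : ℕ) : ℝ) + 1) = c * (((0 : ℕ) : ℝ) + 1) := by
    rw [hc]; push_cast; ring
  rw [this]
end

section
/- Fix 𝔡 > 0 and 𝔲 > 0, and let Q be a Borel probability measure on ℝ². Then there exists a Borel probability measure π on ℝ² × ℝ² such that π(A × ℝ²) = Q(A) and π(ℝ² × A) = bin_𝔡[Q](A) for every Borel set A ⊆ ℝ², and ∫_{ℝ²×ℝ²} min(‖x − y‖, 𝔲) dπ(x, y) ≤ min(√2 · 𝔡, 𝔲). In particular, the truncated 1-Wasserstein distance between Q and bin_𝔡[Q] with truncation level 𝔲, defined as the infimum of ∫ min(‖x−y‖, 𝔲) over all couplings of the two measures, is at most min(√2 · 𝔡, 𝔲). -/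
open MeasureTheory
open scoped ENNReal

/-- The half-open box `[j𝔡, (j+1)𝔡) × [k𝔡, (k+1)𝔡)` of the grid `𝔡 ℤ²` in the plane. -/
def binBox (d : ℝ) (p : ℤ × ℤ) : Set (EuclideanSpace ℝ (Fin 2)) :=
  {x | x 0 ∈ Set.Ico ((p.1 : ℝ) * d) ((p.1 + 1 : ℝ) * d) ∧
       x 1 ∈ Set.Ico ((p.2 : ℝ) * d) ((p.2 + 1 : ℝ) * d)}

/-- The binned version `bin_𝔡[Q]` of a measure `Q` at scale `𝔡`: on each box of the grid `𝔡 ℤ²`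
its density is constant, equal to `Q(box)/𝔡²`, i.e. `bin_𝔡[Q] = ∑ Q(B_{j,k}) · Unif(B_{j,k})`. -/
noncomputable def binned (d : ℝ) (Q : Measure (EuclideanSpace ℝ (Fin 2))) :
    Measure (EuclideanSpace ℝ (Fin 2)) :=
  Measure.sum fun p : ℤ × ℤ =>
    Q (binBox d p) • ((ENNReal.ofReal (d ^ 2))⁻¹ • volume.restrict (binBox d p))


theorem binBox_eq_preimage (d : ℝ) (p : ℤ × ℤ) :
    binBox d p = (WithLp.ofLp : EuclideanSpace ℝ (Fin 2) → (Fin 2 → ℝ)) ⁻¹'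
      (Set.univ.pi fun i : Fin 2 =>
        Set.Ico ((![(p.1 : ℝ), (p.2 : ℝ)] i) * d) ((![(p.1 : ℝ), (p.2 : ℝ)] i + 1) * d)) := by
  ext x
  simp [binBox, Set.mem_pi, Fin.forall_fin_two]

theorem measurableSet_binBox (d : ℝ) (p : ℤ × ℤ) : MeasurableSet (binBox d p) := by
  rw [binBox_eq_preimage]
  exact (PiLp.volume_preserving_ofLp (Fin 2)).measurable
    (MeasurableSet.univ_pi fun i => measurableSet_Ico)

theorem volume_binBox (d : ℝ) (hd : 0 < d) (p : ℤ × ℤ) :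
    volume (binBox d p) = ENNReal.ofReal (d ^ 2) := by
  rw [binBox_eq_preimage, (PiLp.volume_preserving_ofLp (Fin 2)).measure_preimage
    (MeasurableSet.univ_pi fun i => measurableSet_Ico).nullMeasurableSet, Real.volume_pi_Ico]
  simp only [Fin.prod_univ_two]
  rw [← ENNReal.ofReal_mul (by nlinarith)]
  congr 1
  ring

theorem norm_sub_le_of_binBox (d : ℝ) (hd : 0 < d) (p : ℤ × ℤ) (x y : EuclideanSpace ℝ (Fin 2))
    (hx : x ∈ binBox d p) (hy : y ∈ binBox d p) : ‖x - y‖ ≤ Real.sqrt 2 * d := by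
  obtain ⟨⟨h1, h2⟩, h3, h4⟩ := hx
  obtain ⟨⟨k1, k2⟩, k3, k4⟩ := hy
  rw [EuclideanSpace.norm_eq, Real.sqrt_le_left (by positivity), mul_pow, Real.sq_sqrt (by norm_num)]
  simp only [Fin.sum_univ_two, Real.norm_eq_abs, sq_abs, PiLp.sub_apply]
  have a1 : (x 0 - y 0) ^ 2 ≤ d ^ 2 := sq_le_sq' (by linarith) (by linarith)
  have a2 : (x 1 - y 1) ^ 2 ≤ d ^ 2 := sq_le_sq' (by linarith) (by linarith)
  linarith

theorem pairwise_disjoint_binBox (d : ℝ) (hd : 0 < d) :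
    Pairwise (Function.onFun Disjoint (binBox d)) := by
  intro p q hpq
  refine Set.disjoint_left.2 fun x hx hy => hpq ?_
  obtain ⟨⟨h1, h2⟩, h3, h4⟩ := hx
  obtain ⟨⟨k1, k2⟩, k3, k4⟩ := hy
  have key : ∀ (a b : ℤ) (t : ℝ), (a : ℝ) * d ≤ t → t < (b + 1 : ℝ) * d → a ≤ b := by
    intro a b t h h'
    have h3 : (a : ℝ) < b + 1 := lt_of_mul_lt_mul_right (h.trans_lt h') hd.le
    exact Int.lt_add_one_iff.1 (by exact_mod_cast h3)
  exact Prod.ext (le_antisymm (key _ _ _ h1 k2) (key _ _ _ k1 h2))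
    (le_antisymm (key _ _ _ h3 k4) (key _ _ _ k3 h4))

theorem iUnion_binBox (d : ℝ) (hd : 0 < d) : ⋃ p, binBox d p = Set.univ := by
  refine Set.eq_univ_of_forall fun x => Set.mem_iUnion.2 ⟨(⌊x 0 / d⌋, ⌊x 1 / d⌋), ?_⟩
  exact ⟨⟨(le_div_iff₀ hd).1 (Int.floor_le _), (div_lt_iff₀ hd).1 (Int.lt_floor_add_one _)⟩,
    (le_div_iff₀ hd).1 (Int.floor_le _), (div_lt_iff₀ hd).1 (Int.lt_floor_add_one _)⟩

/-- For every `𝔡, 𝔲 > 0` and every Borel probability measure `Q` on the plane there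
is a coupling `π` of `Q` and `bin_𝔡[Q]` with `∫ min(‖x − y‖, 𝔲) dπ ≤ min(√2 𝔡, 𝔲)`; in
particular the truncated 1-Wasserstein distance between `Q` and `bin_𝔡[Q]` is at most
`min(√2 𝔡, 𝔲)`. -/
theorem binned_coupling (d u : ℝ) (hd : 0 < d) (hu : 0 < u)
    (Q : Measure (EuclideanSpace ℝ (Fin 2))) [IsProbabilityMeasure Q] :
    ∃ π : Measure (EuclideanSpace ℝ (Fin 2) × EuclideanSpace ℝ (Fin 2)),
      IsProbabilityMeasure π ∧
      (∀ A : Set (EuclideanSpace ℝ (Fin 2)), MeasurableSet A → π (A ×ˢ Set.univ) = Q A) ∧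
      (∀ A : Set (EuclideanSpace ℝ (Fin 2)), MeasurableSet A → π (Set.univ ×ˢ A) = binned d Q A) ∧
      ∫ z, min ‖z.1 - z.2‖ u ∂π ≤ min (Real.sqrt 2 * d) u := by
  set c : ℝ≥0∞ := (ENNReal.ofReal (d ^ 2))⁻¹ with hc
  have hd2 : ENNReal.ofReal (d ^ 2) ≠ 0 := by
    simpa using hd.ne'
  have hunif : ∀ p, (c • (volume : Measure (EuclideanSpace ℝ (Fin 2))).restrict (binBox d p))
      Set.univ = 1 := by
    intro p
    simp only [Measure.smul_apply, Measure.restrict_apply_univ, volume_binBox d hd, smul_eq_mul]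
    exact ENNReal.inv_mul_cancel hd2 ENNReal.ofReal_ne_top
  let π : Measure (EuclideanSpace ℝ (Fin 2) × EuclideanSpace ℝ (Fin 2)) :=
    Measure.sum fun p : ℤ × ℤ => (Q.restrict (binBox d p)).prod
      (c • volume.restrict (binBox d p))
  have hfin : ∀ p, IsFiniteMeasure
      (c • (volume : Measure (EuclideanSpace ℝ (Fin 2))).restrict (binBox d p)) :=
    fun p => ⟨by rw [hunif p]; exact ENNReal.one_lt_top⟩
  have h1 : ∀ A : Set (EuclideanSpace ℝ (Fin 2)), MeasurableSet A →
      π (A ×ˢ Set.univ) = Q A := by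
    intro A hA
    rw [Measure.sum_apply _ (hA.prod MeasurableSet.univ)]
    have : ∀ p, ((Q.restrict (binBox d p)).prod (c • volume.restrict (binBox d p)))
        (A ×ˢ Set.univ) = Q.restrict (binBox d p) A := by
      intro p
      rw [Measure.prod_prod, hunif, mul_one]
    simp_rw [this]
    rw [← Measure.sum_apply _ hA, ← Measure.restrict_iUnion (pairwise_disjoint_binBox d hd)
      (measurableSet_binBox d), iUnion_binBox d hd, Measure.restrict_univ]
  have hprob : IsProbabilityMeasure π := ⟨by
    rw [← Set.univ_prod_univ, h1 _ MeasurableSet.univ, measure_univ]⟩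
  refine ⟨π, hprob, h1, ?_, ?_⟩
  · intro A hA
    rw [binned, Measure.sum_apply _ (MeasurableSet.univ.prod hA), Measure.sum_apply _ hA]
    refine tsum_congr fun p => ?_
    rw [Measure.prod_prod, Measure.restrict_apply_univ]
    rfl
  · have hae : ∀ᵐ z ∂π, min ‖z.1 - z.2‖ u ≤ min (Real.sqrt 2 * d) u := by
      refine Measure.ae_sum_iff.2 fun p => ?_
      have e : (Q.restrict (binBox d p)).prod (c • volume.restrict (binBox d p)) =
          (Q.prod (c • volume.restrict (binBox d p))).restrict (binBox d p ×ˢ binBox d p) := by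
        rw [← Measure.prod_restrict, Measure.restrict_smul,
          Measure.restrict_restrict (measurableSet_binBox d p), Set.inter_self]
      rw [e]
      refine (ae_restrict_iff' ((measurableSet_binBox d p).prod (measurableSet_binBox d p))).2
        (Filter.Eventually.of_forall fun z hz => ?_)
      exact min_le_min_right _ (norm_sub_le_of_binBox d hd p _ _ hz.1 hz.2)
    calc ∫ z, min ‖z.1 - z.2‖ u ∂π ≤ ∫ _, min (Real.sqrt 2 * d) u ∂π :=
          integral_mono_of_nonneg
            (Filter.Eventually.of_forall fun z => le_min (norm_nonneg _) hu.le)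
            (integrable_const _) hae
      _ = min (Real.sqrt 2 * d) u := by simp
end

section
/- Let A, B : [0,∞) → ℝ be continuous nondecreasing functions with A(0) = B(0) = 0, let f₀ ≤ 0 be a real number, and define f(t) := f₀ + A(t) − B(t). Assume that A is flat on every interval where f is nonnegative: for all 0 ≤ u ≤ v, if f(r) ≥ 0 for every r ∈ [u, v], then A(v) = A(u). Then f(t) ≤ 0 for every t ≥ 0. -/
/-- If `f(t) = f₀ + A(t) − B(t)` with `f₀ ≤ 0`, `A, B` continuous nondecreasing
vanishing at `0`, and `A` is flat on every interval where `f` is nonnegative, then `f ≤ 0` on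
`[0,∞)`. -/
theorem reflection_comparison_nonpos (A B : ℝ → ℝ) (f₀ : ℝ) (f : ℝ → ℝ)
    (hAc : ContinuousOn A (Set.Ici 0)) (hBc : ContinuousOn B (Set.Ici 0))
    (hAm : MonotoneOn A (Set.Ici 0)) (hBm : MonotoneOn B (Set.Ici 0))
    (hA0 : A 0 = 0) (hB0 : B 0 = 0) (hf₀ : f₀ ≤ 0)
    (hf : ∀ t, f t = f₀ + A t - B t)
    (hflat : ∀ u v : ℝ, 0 ≤ u → u ≤ v → (∀ r ∈ Set.Icc u v, 0 ≤ f r) → A v = A u) :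
    ∀ t, 0 ≤ t → f t ≤ 0 := by
  intro t ht
  by_contra hpos
  rw [not_le] at hpos
  have hfc : ContinuousOn f (Set.Ici 0) := by
    have h : f = fun t => f₀ + A t - B t := funext hf
    rw [h]
    exact (continuousOn_const.add hAc).sub hBc
  have hfc' : ContinuousOn f (Set.Icc 0 t) := hfc.mono Set.Icc_subset_Ici_self
  have hcl : IsClosed (Set.Icc 0 t ∩ f ⁻¹' Set.Iic 0) :=
    hfc'.preimage_isClosed_of_isClosed isClosed_Icc isClosed_Iic
  have hcpt : IsCompact (Set.Icc 0 t ∩ f ⁻¹' Set.Iic 0) :=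
    isCompact_Icc.of_isClosed_subset hcl Set.inter_subset_left
  have hne : (Set.Icc 0 t ∩ f ⁻¹' Set.Iic 0).Nonempty := by
    refine ⟨0, ⟨le_refl _, ht⟩, ?_⟩
    simp only [Set.mem_preimage, Set.mem_Iic]
    rw [hf, hA0, hB0]
    linarith
  obtain ⟨s, ⟨⟨⟨hs0, hst⟩, hfs⟩, hmax⟩⟩ := hcpt.exists_isGreatest hne
  have hfs' : f s ≤ 0 := hfs
  have hfcs : ContinuousOn f (Set.Icc s t) := hfc'.mono (Set.Icc_subset_Icc_left hs0)
  obtain ⟨c, ⟨hsc, hct⟩, hc⟩ := intermediate_value_Icc hst hfcs ⟨hfs', hpos.le⟩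
  have hcs : c ≤ s := hmax ⟨⟨hs0.trans hsc, hct⟩, hc.le⟩
  have hcs' : c = s := le_antisymm hcs hsc
  subst hcs'
  have hA := hflat c t hs0 hst (by
    rintro r ⟨hr1, hr2⟩
    by_contra hr
    rw [not_le] at hr
    have hrc : r ≤ c := hmax ⟨⟨hs0.trans hr1, hr2⟩, hr.le⟩
    have : r = c := le_antisymm hrc hr1
    rw [this, hc] at hr
    exact lt_irrefl _ hr)
  have hB := hBm (Set.mem_Ici.2 hs0) (Set.mem_Ici.2 ht) hst
  rw [hf] at hc hpos
  linarith
end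

section
/- Let A, B : [0,∞) → ℝ be continuous nondecreasing functions with A(0) = B(0) = 0, let f₀ ∈ ℝ, and define f(t) := f₀ + A(t) − B(t). Assume: for all 0 ≤ u ≤ v, if f(r) ≥ 0 for every r ∈ [u, v] then A(v) = A(u); and for all 0 ≤ u ≤ v, if f(r) ≤ 0 for every r ∈ [u, v] then B(v) = B(u). Then the function t ↦ |f(t)| is nonincreasing on [0,∞); in particular |f(t)| ≤ |f₀| for all t ≥ 0. -/
theorem reflection_pos_aux (A B : ℝ → ℝ) (f₀ : ℝ) (f : ℝ → ℝ)
    (hAc : ContinuousOn A (Set.Ici 0)) (hBc : ContinuousOn B (Set.Ici 0))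
    (hBm : MonotoneOn B (Set.Ici 0))
    (hf : ∀ t, f t = f₀ + A t - B t)
    (hflatA : ∀ u v : ℝ, 0 ≤ u → u ≤ v → (∀ r ∈ Set.Icc u v, 0 ≤ f r) → A v = A u)
    (s t : ℝ) (hs : 0 ≤ s) (hst : s ≤ t) (ht : 0 < f t) : f t ≤ f s := by
  have hfc : ContinuousOn f (Set.Ici 0) := by
    have : f = fun t => f₀ + A t - B t := funext hf
    rw [this]
    exact (continuousOn_const.add hAc).sub hBc
  have key : ∀ u, 0 ≤ u → u ≤ t → (∀ r ∈ Set.Icc u t, 0 ≤ f r) → f t ≤ f u := by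
    intro u hu hut h
    have h1 := hflatA u t hu hut h
    have h2 := hBm (Set.mem_Ici.2 hu) (Set.mem_Ici.2 (hu.trans hut)) hut
    rw [hf, hf]
    linarith
  have ivt : ∀ r, 0 ≤ r → r ≤ t → f r ≤ 0 → ∃ z ∈ Set.Icc r t, f z = 0 := by
    intro r hr hrt h
    have := intermediate_value_Icc hrt
      (hfc.mono (fun x hx => Set.mem_Ici.2 (hr.trans hx.1)))
    obtain ⟨z, hz, hz0⟩ := this ⟨h, ht.le⟩
    exact ⟨z, hz, hz0⟩
  by_cases hall : ∀ r ∈ Set.Icc s t, 0 ≤ f r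
  · exact key s hs hst hall
  exfalso
  push Not at hall
  obtain ⟨r, hr, hr0⟩ := hall
  obtain ⟨z, hz, hz0⟩ := ivt r (hs.trans hr.1) hr.2 hr0.le
  have hcl : IsClosed (Set.Icc s t ∩ f ⁻¹' {0}) :=
    (hfc.mono (fun x hx => Set.mem_Ici.2 (hs.trans hx.1))).preimage_isClosed_of_isClosed
      isClosed_Icc isClosed_singleton
  have hcp : IsCompact (Set.Icc s t ∩ f ⁻¹' {0}) :=
    isCompact_Icc.of_isClosed_subset hcl Set.inter_subset_left
  obtain ⟨σ, ⟨hσ, hσ0⟩, hmax⟩ := hcp.exists_isGreatest ⟨z, ⟨hr.1.trans hz.1, hz.2⟩, hz0⟩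
  have hσ0' : f σ = 0 := hσ0
  have := key σ (hs.trans hσ.1) hσ.2 (by
    intro x hx
    by_contra hneg
    push Not at hneg
    obtain ⟨y, hy, hy0⟩ := ivt x (hs.trans (hσ.1.trans hx.1)) hx.2 hneg.le
    have h1 : y ≤ σ := hmax ⟨⟨hσ.1.trans (hx.1.trans hy.1), hy.2⟩, hy0⟩
    have h2 : x = σ := le_antisymm (hy.1.trans h1) hx.1
    rw [h2] at hneg
    linarith)
  linarith

/-- If `f(t) = f₀ + A(t) − B(t)` with `A, B` continuous nondecreasing vanishing at
`0`, `A` flat on intervals where `f ≥ 0` and `B` flat on intervals where `f ≤ 0`, then `|f|` is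
nonincreasing on `[0,∞)`; in particular `|f t| ≤ |f₀|` for all `t ≥ 0`. -/
theorem abs_reflection_difference_antitone (A B : ℝ → ℝ) (f₀ : ℝ) (f : ℝ → ℝ)
    (hAc : ContinuousOn A (Set.Ici 0)) (hBc : ContinuousOn B (Set.Ici 0))
    (hAm : MonotoneOn A (Set.Ici 0)) (hBm : MonotoneOn B (Set.Ici 0))
    (hA0 : A 0 = 0) (hB0 : B 0 = 0)
    (hf : ∀ t, f t = f₀ + A t - B t)
    (hflatA : ∀ u v : ℝ, 0 ≤ u → u ≤ v → (∀ r ∈ Set.Icc u v, 0 ≤ f r) → A v = A u)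
    (hflatB : ∀ u v : ℝ, 0 ≤ u → u ≤ v → (∀ r ∈ Set.Icc u v, f r ≤ 0) → B v = B u) :
    AntitoneOn (fun t => |f t|) (Set.Ici 0) ∧ ∀ t, 0 ≤ t → |f t| ≤ |f₀| := by
  have main : ∀ s t, 0 ≤ s → s ≤ t → |f t| ≤ |f s| := by
    intro s t hs hst
    rcases lt_trichotomy (f t) 0 with h | h | h
    · have := reflection_pos_aux B A (-f₀) (fun x => -f x) hBc hAc hAm
        (fun x => by simp only [hf x]; ring)
        (fun u v hu huv hr => hflatB u v hu huv (fun r hr' => by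
          have := hr r hr'
          linarith)) s t hs hst (by linarith)
      rw [abs_of_neg h]
      exact this.trans (neg_le_abs _)
    · rw [h, abs_zero]
      exact abs_nonneg _
    · have := reflection_pos_aux A B f₀ f hAc hBc hBm hf hflatA s t hs hst h
      rw [abs_of_pos h]
      exact this.trans (le_abs_self _)
  refine ⟨fun s hs t _ hst => main s t hs hst, fun t ht => ?_⟩
  have := main 0 t le_rfl ht
  have h0 : f 0 = f₀ := by rw [hf, hA0, hB0]; ring
  rwa [h0] at this
end

section
/- Let w : [0,∞) → ℝ be continuous with w(0) = 0, and let y₀ ≥ 0 and ỹ₀ ≥ 0. Suppose y, ỹ, K, K̃ : [0,∞) → ℝ are continuous functions such that: y(t) = y₀ + w(t) + K(t) ≥ 0 and ỹ(t) = ỹ₀ + w(t) + K̃(t) ≥ 0 for all t ≥ 0; K and K̃ are nondecreasing with K(0) = K̃(0) = 0; and for all 0 ≤ u ≤ v, if y(r) > 0 for every r ∈ [u, v] then K(v) = K(u), and if ỹ(r) > 0 for every r ∈ [u, v] then K̃(v) = K̃(u). Then |y(t) − ỹ(t)| ≤ |y₀ − ỹ₀| for every t ≥ 0. (Two Skorokhod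 reflections on the half-line [0,∞) of paths driven by the same continuous input but with different starting points never move further apart than their initial distance.) -/
lemma skorokhod_one_sided (w f g K L : ℝ → ℝ) (a b C : ℝ)
    (hC : 0 ≤ C) (hab : a - b ≤ C) (hw0 : w 0 = 0)
    (hfc : ContinuousOn f (Set.Ici 0)) (hgc : ContinuousOn g (Set.Ici 0))
    (hf : ∀ t, 0 ≤ t → f t = a + w t + K t)
    (hg : ∀ t, 0 ≤ t → g t = b + w t + L t)
    (hgn : ∀ t, 0 ≤ t → 0 ≤ g t)
    (hL : MonotoneOn L (Set.Ici 0)) (hK0 : K 0 = 0) (hL0 : L 0 = 0)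
    (hflat : ∀ u v : ℝ, 0 ≤ u → u ≤ v → (∀ r ∈ Set.Icc u v, 0 < f r) → K v = K u)
    (t : ℝ) (ht : 0 ≤ t) : f t - g t ≤ C := by
  by_contra! hlt
  have hd : ContinuousOn (fun r => f r - g r) (Set.Ici 0) := hfc.sub hgc
  have hd' : ContinuousOn (fun r => f r - g r) (Set.Icc 0 t) :=
    hd.mono Set.Icc_subset_Ici_self
  have hcl : IsClosed (Set.Icc 0 t ∩ (fun r => f r - g r) ⁻¹' Set.Iic C) :=
    hd'.preimage_isClosed_of_isClosed isClosed_Icc isClosed_Iic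
  have hcp : IsCompact (Set.Icc 0 t ∩ (fun r => f r - g r) ⁻¹' Set.Iic C) :=
    isCompact_Icc.of_isClosed_subset hcl Set.inter_subset_left
  have h0 : f 0 - g 0 ≤ C := by
    rw [hf 0 le_rfl, hg 0 le_rfl]; linarith
  obtain ⟨s, ⟨⟨hs0, hst⟩, hsC⟩, hmax⟩ :=
    hcp.exists_isGreatest ⟨0, ⟨le_rfl, ht⟩, h0⟩
  simp only [Set.mem_preimage, Set.mem_Iic] at hsC
  have hst' : s < t := by
    rcases hst.lt_or_eq with h | h
    · exact h
    · subst h; linarith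
  have hgt : ∀ r, s < r → r ≤ t → C < f r - g r := by
    intro r h1 h2
    by_contra! h3
    have : r ≤ s := hmax ⟨⟨hs0.trans h1.le, h2⟩, h3⟩
    linarith
  have hge : ∀ r, s < r → r ≤ t → f t - g t ≤ f r - g r := by
    intro r h1 h2
    have hr0 : 0 ≤ r := hs0.trans h1.le
    have hk := hflat r t hr0 h2 (fun q hq => by
      have := hgt q (h1.trans_le hq.1) hq.2
      have := hgn q (hr0.trans hq.1)
      linarith)
    have hl : L r ≤ L t := hL hr0 ht h2
    rw [hf t ht, hg t ht, hf r hr0, hg r hr0]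
    linarith
  have hlim : Filter.Tendsto (fun r => f r - g r) (nhdsWithin s (Set.Ioi s))
      (nhds (f s - g s)) :=
    (hd s hs0).mono_left (nhdsWithin_mono s (fun r hr => hs0.trans (le_of_lt hr)))
  have : f t - g t ≤ f s - g s := by
    refine ge_of_tendsto hlim ?_
    filter_upwards [Ioc_mem_nhdsGT hst'] with r hr
    exact hge r hr.1 hr.2
  linarith

/-- Two Skorokhod reflections on the half-line `[0,∞)` of paths driven by the same
continuous input `w` but with different starting points `y₀, y₁ ≥ 0` never move further apart
than their initial distance. -/
theorem skorokhod_reflection_contraction (w y₀fn y₁fn K₀ K₁ : ℝ → ℝ) (y₀ y₁ : ℝ)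
    (hwc : ContinuousOn w (Set.Ici 0)) (hw0 : w 0 = 0)
    (hy₀ : 0 ≤ y₀) (hy₁ : 0 ≤ y₁)
    (hy₀c : ContinuousOn y₀fn (Set.Ici 0)) (hy₁c : ContinuousOn y₁fn (Set.Ici 0))
    (hK₀c : ContinuousOn K₀ (Set.Ici 0)) (hK₁c : ContinuousOn K₁ (Set.Ici 0))
    (hy₀eq : ∀ t, 0 ≤ t → y₀fn t = y₀ + w t + K₀ t)
    (hy₁eq : ∀ t, 0 ≤ t → y₁fn t = y₁ + w t + K₁ t)
    (hy₀nonneg : ∀ t, 0 ≤ t → 0 ≤ y₀fn t)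
    (hy₁nonneg : ∀ t, 0 ≤ t → 0 ≤ y₁fn t)
    (hK₀m : MonotoneOn K₀ (Set.Ici 0)) (hK₁m : MonotoneOn K₁ (Set.Ici 0))
    (hK₀0 : K₀ 0 = 0) (hK₁0 : K₁ 0 = 0)
    (hK₀flat : ∀ u v : ℝ, 0 ≤ u → u ≤ v → (∀ r ∈ Set.Icc u v, 0 < y₀fn r) → K₀ v = K₀ u)
    (hK₁flat : ∀ u v : ℝ, 0 ≤ u → u ≤ v → (∀ r ∈ Set.Icc u v, 0 < y₁fn r) → K₁ v = K₁ u) :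
    ∀ t, 0 ≤ t → |y₀fn t - y₁fn t| ≤ |y₀ - y₁| := by
  intro t ht
  rw [abs_le]
  have h1 := skorokhod_one_sided w y₀fn y₁fn K₀ K₁ y₀ y₁ |y₀ - y₁| (abs_nonneg _) (le_abs_self _)
    hw0 hy₀c hy₁c hy₀eq hy₁eq hy₁nonneg hK₁m hK₀0 hK₁0 hK₀flat t ht
  have h2 := skorokhod_one_sided w y₁fn y₀fn K₁ K₀ y₁ y₀ |y₀ - y₁| (abs_nonneg _)
    (by rw [abs_sub_comm]; exact le_abs_self _)
    hw0 hy₁c hy₀c hy₁eq hy₀eq hy₀nonneg hK₀m hK₁0 hK₀0 hK₁flat t ht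
  constructor <;> linarith
end

section
/- Let κ > 0 and let φ : ℝ → ℝ² be a twice continuously differentiable unit-speed curve with ‖φ'(t)‖ = 1 for all t and ‖φ''(t)‖ ≤ κ for all t. Let x₀ ∈ ℝ² satisfy ⟨φ'(0), φ(0) − x₀⟩ = 0 (that is, φ(0) is a foot point of x₀ on the curve), and let r > 0 satisfy κ r < 1/2. Then ‖φ(2r) − x₀‖ > r and ‖φ(−2r) − x₀‖ > r; in other words, within arc length 2r in either direction from the foot point, the curve exits the open ball of radius r centered at x₀. -/
open scoped RealInnerProductSpace

/-- If `φ(0)` is a foot point of `x₀` on a unit-speed curve of curvature at most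
`κ`, and `κ r < 1/2`, then within arc length `2r` in either direction the curve exits the open
ball of radius `r` centered at `x₀`. -/
theorem curve_exits_ball (κ : ℝ) (hκ : 0 < κ) (φ : ℝ → EuclideanSpace ℝ (Fin 2))
    (hφ : ContDiff ℝ 2 φ)
    (hunit : ∀ t, ‖deriv φ t‖ = 1)
    (hcurv : ∀ t, ‖deriv (deriv φ) t‖ ≤ κ)
    (x₀ : EuclideanSpace ℝ (Fin 2)) (hfoot : ⟪deriv φ 0, φ 0 - x₀⟫ = 0)
    (r : ℝ) (hr : 0 < r) (hκr : κ * r < 1 / 2) :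
    r < ‖φ (2 * r) - x₀‖ ∧ r < ‖φ (-(2 * r)) - x₀‖ := by
  have hd : Differentiable ℝ φ := hφ.differentiable (by norm_num)
  have hd2 : Differentiable ℝ (deriv φ) := by
    have h : ContDiff ℝ 1 (deriv φ) := by
      have h2 : ContDiff ℝ (1 + 1) φ := by
        rw [one_add_one_eq_two]; exact hφ
      exact (contDiff_succ_iff_deriv.1 h2).2.2
    exact h.differentiable (by norm_num)
  have key : ∀ c : ℝ, |c| ≤ 2 * r → 1 / 2 < ⟪deriv φ 0, deriv φ c⟫ := by
    intro c hc
    have h1 : ‖deriv φ c - deriv φ 0‖ ≤ κ * ‖c - 0‖ :=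
      convex_univ.norm_image_sub_le_of_norm_deriv_le (fun x _ => hd2 x)
        (fun x _ => hcurv x) (Set.mem_univ _) (Set.mem_univ _)
    rw [sub_zero, Real.norm_eq_abs] at h1
    have h2 : ‖deriv φ c - deriv φ 0‖ < 1 := by nlinarith
    have h3 := norm_sub_sq_real (deriv φ c) (deriv φ 0)
    rw [hunit, hunit, real_inner_comm] at h3
    nlinarith [norm_nonneg (deriv φ c - deriv φ 0)]
  have hg : ∀ t, HasDerivAt (fun t => ⟪deriv φ 0, φ t - x₀⟫) ⟪deriv φ 0, deriv φ t⟫ t := by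
    intro t
    have h := (innerSL ℝ (deriv φ 0)).hasFDerivAt.comp_hasDerivAt t
      ((hd t).hasDerivAt.sub_const x₀)
    exact h
  have hcont : Continuous (fun t => ⟪deriv φ 0, φ t - x₀⟫) :=
    continuous_iff_continuousAt.2 fun t => (hg t).continuousAt
  have hcs : ∀ t, |⟪deriv φ 0, φ t - x₀⟫| ≤ ‖φ t - x₀‖ := by
    intro t
    have h := abs_real_inner_le_norm (deriv φ 0) (φ t - x₀)
    rwa [hunit, one_mul] at h
  constructor
  · obtain ⟨c, hc, h⟩ := exists_hasDerivAt_eq_slope (fun t => ⟪deriv φ 0, φ t - x₀⟫)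
      (fun t => ⟪deriv φ 0, deriv φ t⟫) (show (0 : ℝ) < 2 * r by linarith)
      hcont.continuousOn (fun t _ => hg t)
    have hk := key c (abs_le.2 ⟨by linarith [hc.1], hc.2.le⟩)
    simp only [hfoot] at h
    rw [h, lt_div_iff₀ (by linarith)] at hk
    have := le_abs_self ⟪deriv φ 0, φ (2 * r) - x₀⟫
    linarith [hcs (2 * r)]
  · obtain ⟨c, hc, h⟩ := exists_hasDerivAt_eq_slope (fun t => ⟪deriv φ 0, φ t - x₀⟫)
      (fun t => ⟪deriv φ 0, deriv φ t⟫) (show -(2 * r) < (0 : ℝ) by linarith)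
      hcont.continuousOn (fun t _ => hg t)
    have hk := key c (abs_le.2 ⟨hc.1.le, by linarith [hc.2]⟩)
    simp only [hfoot] at h
    rw [h, lt_div_iff₀ (by linarith)] at hk
    have := neg_le_abs ⟪deriv φ 0, φ (-(2 * r)) - x₀⟫
    linarith [hcs (-(2 * r))]
end

section
/- Let κ > 0 and let φ : ℝ → ℝ² be a twice continuously differentiable unit-speed curve with ‖φ'(t)‖ = 1 for all t and ‖φ''(t)‖ ≤ κ for all t. Then for every s with 0 < s < 2/κ one has ⟨φ'(0), φ(s) − φ(0)⟩ > 0, and for every s with −2/κ < s < 0 one has ⟨φ'(0), φ(s) − φ(0)⟩ < 0. In particular, for every s with 0 < |s| < 2/κ, the point φ(s) does not lie on the normal line {φ(0) + α n̂ : α ∈ ℝ} through φ(0), where n̂ is a unit vector orthogonal to φ'(0). -/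
open scoped RealInnerProductSpace

theorem tangential_aux {E : Type*} [NormedAddCommGroup E] [InnerProductSpace ℝ E]
    (κ : ℝ) (hκ : 0 < κ) (f v w : ℝ → E)
    (hf : ∀ t, HasDerivAt f (v t) t) (hv : ∀ t, HasDerivAt v (w t) t)
    (hunit : ∀ t, ‖v t‖ = 1) (hw : ∀ t, ‖w t‖ ≤ κ) (s : ℝ) (hs : 0 < s) (hs2 : s < 2 / κ) :
    0 < ⟪v 0, f s - f 0⟫ := by
  have hlip : ∀ t : ℝ, 0 ≤ t → ‖v t - v 0‖ ≤ κ * t := by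
    intro t ht
    have h := Convex.norm_image_sub_le_of_norm_hasDerivWithin_le (f := v) (f' := w) (s := Set.univ)
      (C := κ) (fun x _ => (hv x).hasDerivWithinAt) (fun x _ => hw x) convex_univ
      (Set.mem_univ (0 : ℝ)) (Set.mem_univ t)
    simpa [abs_of_nonneg ht] using h
  have hin : ∀ t : ℝ, 0 ≤ t → 1 - κ * t ≤ ⟪v 0, v t⟫ := by
    intro t ht
    have h1 : ⟪v 0, v t⟫ = 1 + ⟪v 0, v t - v 0⟫ := by
      rw [inner_sub_right, real_inner_self_eq_norm_sq, hunit]; ring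
    have h2 := abs_real_inner_le_norm (v 0) (v t - v 0)
    rw [hunit, one_mul] at h2
    have h3 := (abs_le.1 (h2.trans (hlip t ht))).1
    linarith
  have hg : ∀ t : ℝ, HasDerivAt (fun t => ⟪v 0, f t⟫ - t + κ / 2 * t ^ 2)
      (⟪v 0, v t⟫ - 1 + κ * t) t := by
    intro t
    have h1 : HasDerivAt (fun t => ⟪v 0, f t⟫) ⟪v 0, v t⟫ t := by
      simpa using (hasDerivAt_const t (v 0)).inner ℝ (hf t)
    have h2 := (h1.sub (hasDerivAt_id t)).add (((hasDerivAt_id t).pow 2).const_mul (κ / 2))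
    refine HasDerivAt.congr_deriv (f := fun t => ⟪v 0, f t⟫ - t + κ / 2 * t ^ 2) h2 ?_
    simp only [id]
    push_cast
    ring
  have hmono : MonotoneOn (fun t => ⟪v 0, f t⟫ - t + κ / 2 * t ^ 2) (Set.Ici 0) := by
    apply monotoneOn_of_deriv_nonneg (convex_Ici 0)
    · exact fun t _ => (hg t).continuousAt.continuousWithinAt
    · exact fun t _ => (hg t).differentiableAt.differentiableWithinAt
    · intro t ht
      rw [interior_Ici] at ht
      rw [(hg t).deriv]
      linarith [hin t (le_of_lt ht)]
  have h := hmono (Set.mem_Ici.2 le_rfl) (Set.mem_Ici.2 hs.le) hs.le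
  simp only at h
  rw [inner_sub_right]
  rw [lt_div_iff₀ hκ] at hs2
  nlinarith [mul_pos hs (sub_pos.2 hs2)]

/-- Along a unit-speed curve of curvature at most `κ`, the tangential coordinate
`⟨φ'(0), φ(s) − φ(0)⟩` is strictly positive for `0 < s < 2/κ` and strictly negative for
`−2/κ < s < 0`. In particular, for `0 < |s| < 2/κ` the point `φ(s)` does not lie on the normal
line through `φ(0)`. -/
theorem curve_tangential_sign (κ : ℝ) (hκ : 0 < κ) (φ : ℝ → EuclideanSpace ℝ (Fin 2))
    (hφ : ContDiff ℝ 2 φ)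
    (hunit : ∀ t, ‖deriv φ t‖ = 1)
    (hcurv : ∀ t, ‖deriv (deriv φ) t‖ ≤ κ) :
    (∀ s : ℝ, 0 < s → s < 2 / κ → 0 < ⟪deriv φ 0, φ s - φ 0⟫) ∧
    (∀ s : ℝ, -(2 / κ) < s → s < 0 → ⟪deriv φ 0, φ s - φ 0⟫ < 0) ∧
    (∀ nhat : EuclideanSpace ℝ (Fin 2), ‖nhat‖ = 1 → ⟪nhat, deriv φ 0⟫ = 0 →
      ∀ s : ℝ, s ≠ 0 → |s| < 2 / κ → ∀ α : ℝ, φ s ≠ φ 0 + α • nhat) := by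
  have hf : ∀ t, HasDerivAt φ (deriv φ t) t := fun t =>
    (hφ.differentiable (by norm_num) t).hasDerivAt
  have hd : ContDiff ℝ 1 (deriv φ) := by
    have h : ContDiff ℝ (1 + 1) φ := by
      rw [one_add_one_eq_two]; exact hφ
    exact (contDiff_succ_iff_deriv.1 h).2.2
  have hv : ∀ t, HasDerivAt (deriv φ) (deriv (deriv φ) t) t := fun t =>
    (hd.differentiable (by norm_num) t).hasDerivAt
  have hpos : ∀ s : ℝ, 0 < s → s < 2 / κ → 0 < ⟪deriv φ 0, φ s - φ 0⟫ :=
    tangential_aux κ hκ φ (deriv φ) (deriv (deriv φ)) hf hv hunit hcurv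
  have hneg : ∀ s : ℝ, -(2 / κ) < s → s < 0 → ⟪deriv φ 0, φ s - φ 0⟫ < 0 := by
    intro s h1 h2
    have hf' : ∀ t, HasDerivAt (fun t => φ (-t)) (-deriv φ (-t)) t := fun t => by
      have h := (hf (-t)).scomp t (hasDerivAt_neg t)
      rw [neg_one_smul] at h
      exact h
    have hv' : ∀ t, HasDerivAt (fun t => -deriv φ (-t)) (deriv (deriv φ) (-t)) t := fun t => by
      have h := ((hv (-t)).scomp t (hasDerivAt_neg t)).neg
      rw [neg_one_smul, neg_neg] at h
      exact h
    have h := tangential_aux κ hκ (fun t => φ (-t)) (fun t => -deriv φ (-t))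
      (fun t => deriv (deriv φ) (-t))
      hf' hv'
      (fun t => by simpa using hunit (-t)) (fun t => hcurv (-t)) (-s) (by linarith) (by linarith)
    simpa [inner_neg_left] using h
  refine ⟨hpos, hneg, ?_⟩
  intro nhat _ hn s hs hs2 α heq
  have h0 : ⟪deriv φ 0, φ s - φ 0⟫ = 0 := by
    rw [heq, add_sub_cancel_left, inner_smul_right, real_inner_comm, hn, mul_zero]
  rw [abs_lt] at hs2
  rcases lt_or_gt_of_ne hs with h | h
  · linarith [hneg s hs2.1 h]
  · linarith [hpos s h hs2.2]
end
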